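/- arXiv:1908.04152 — 6 statements merged into one kernel-verified Lean document; each statement's English description precedes it below -/
import Mathlib

section
/- For all integers i, s, s′ with 1 ≤ s ≤ s′ ≤ i ≤ n, one has u_i^s · u_i^{s′} = (q-1)·u_{i-1}^{s-1} · u_i^{s′} + q·u_{i-1}^{s′-1} · u_i^{s-1} in A. -/
/-- `uElt T i j` is the element `u_i^j`: the product `T_i T_{i-1} ⋯ T_{i-j+1}`
(interpreted as `1` when `j = 0`). -/
def uElt {A : Type*} [Monoid A] (T : ℕ → A) (i j : ℕ) : A :=
  ((List.range j).map fun t => T (i - t)).prod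

theorem uElt_succ_right {A : Type*} [Monoid A] (T : ℕ → A) (i j : ℕ) :
    uElt T i (j + 1) = uElt T i j * T (i - j) := by
  simp [uElt, List.range_succ]

theorem uElt_one_add {A : Type*} [Monoid A] (T : ℕ → A) (i j : ℕ) :
    uElt T i (j + 1) = T i * uElt T (i - 1) j := by
  induction j with
  | zero => simp [uElt]
  | succ j ih =>
    rw [uElt_succ_right, ih, uElt_succ_right, mul_assoc]
    congr 3
    omega

/-- A generator commutes with a product of generators that are far from it. -/
theorem uElt_comm_far {A : Type*} [Monoid A] (n : ℕ) (T : ℕ → A)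
    (hcomm : ∀ j k, 1 ≤ j → j ≤ n → 1 ≤ k → k ≤ n → 2 ≤ |(j : ℤ) - (k : ℤ)| →
      T j * T k = T k * T j)
    (i k : ℕ) (hin : i ≤ n) (hk : 1 ≤ k) (j : ℕ) (hj : j + k + 1 ≤ i) :
    T k * uElt T i j = uElt T i j * T k := by
  induction j with
  | zero => simp [uElt]
  | succ j ih =>
    have hc : T k * T (i - j) = T (i - j) * T k := by
      apply hcomm <;> try omega
      rw [le_abs]
      omega
    rw [uElt_succ_right, ← mul_assoc, ih (by omega), mul_assoc, hc, mul_assoc]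

/-- Moving a generator through `u_i^m` raises its index by one. -/
theorem uElt_shift {A : Type*} [Monoid A] (n : ℕ) (T : ℕ → A)
    (hcomm : ∀ j k, 1 ≤ j → j ≤ n → 1 ≤ k → k ≤ n → 2 ≤ |(j : ℤ) - (k : ℤ)| →
      T j * T k = T k * T j)
    (hbraid : ∀ j, 1 ≤ j → j + 1 ≤ n →
      T j * T (j + 1) * T j = T (j + 1) * T j * T (j + 1))
    (i k d : ℕ) (hin : i ≤ n) (hk : 1 ≤ k) (hd : i = k + d + 1)
    (m : ℕ) (hm : d + 2 ≤ m) (hmi : m ≤ i) :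
    T k * uElt T i m = uElt T i m * T (k + 1) := by
  induction m, hm using Nat.le_induction with
  | base =>
    have e1 : i - d = k + 1 := by omega
    have e2 : i - (d + 1) = k := by omega
    rw [uElt_succ_right, uElt_succ_right, e1, e2, ← mul_assoc, ← mul_assoc,
      uElt_comm_far n T hcomm i k hin hk d (by omega)]
    have := hbraid k hk (by omega)
    simp only [mul_assoc] at this ⊢
    rw [this]
  | succ m hm ih =>
    have hc : T (k + 1) * T (i - m) = T (i - m) * T (k + 1) := by
      apply hcomm <;> try omega
      rw [le_abs]
      omega
    rw [uElt_succ_right, ← mul_assoc, ih (by omega), mul_assoc, hc, mul_assoc]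

theorem u_mul_u_le {K : Type*} [Field K] (q : K) {A : Type*} [Ring A] [Algebra K A]
    (n : ℕ) (T : ℕ → A)
    (hcomm : ∀ j k, 1 ≤ j → j ≤ n → 1 ≤ k → k ≤ n → 2 ≤ |(j : ℤ) - (k : ℤ)| →
      T j * T k = T k * T j)
    (hbraid : ∀ j, 1 ≤ j → j + 1 ≤ n →
      T j * T (j + 1) * T j = T (j + 1) * T j * T (j + 1))
    (hquad : ∀ j, 1 ≤ j → j ≤ n → T j ^ 2 = (q - 1) • T j + q • (1 : A))
    (i s s' : ℕ) (hs : 1 ≤ s) (hss' : s ≤ s') (hs'i : s' ≤ i) (hin : i ≤ n) :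
    uElt T i s * uElt T i s' =
      (q - 1) • (uElt T (i - 1) (s - 1) * uElt T i s') +
        q • (uElt T (i - 1) (s' - 1) * uElt T i (s - 1)) := by
  induction s, hs using Nat.le_induction with
  | base =>
    obtain ⟨m, rfl⟩ : ∃ m, s' = m + 1 := ⟨s' - 1, by omega⟩
    have h1 : uElt T i 1 = T i := by simp [uElt]
    have h0 : ∀ l, uElt T l 0 = 1 := by simp [uElt]
    have hq := hquad i (by omega) hin
    simp only [Nat.sub_self, Nat.add_sub_cancel, h0, h1, one_mul, mul_one]
    rw [uElt_one_add, ← mul_assoc, ← pow_two, hq, add_mul, smul_mul_assoc, smul_mul_assoc,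
      one_mul]
  | succ s hs ih =>
    obtain ⟨r, rfl⟩ : ∃ r, s = r + 1 := ⟨s - 1, by omega⟩
    have hsh := uElt_shift n T hcomm hbraid i (i - (r + 1)) r hin (by omega) (by omega) s'
      (by omega) hs'i
    have e : i - (r + 1) + 1 = i - r := by omega
    have e' : i - 1 - r = i - (r + 1) := by omega
    rw [e] at hsh
    have ih' := ih (by omega)
    simp only [Nat.add_sub_cancel] at ih' ⊢
    rw [uElt_succ_right T i (r + 1), mul_assoc, hsh, ← mul_assoc, ih', add_mul,
      smul_mul_assoc, smul_mul_assoc, mul_assoc, ← hsh, uElt_succ_right T (i - 1) r, e',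
      uElt_succ_right T i r]
    simp only [mul_assoc]
end

section
/- For every l ∈ ℒ_n and every integer s with 0 ≤ s ≤ n, the product β_n^l · u_n^s lies in the K-linear span of the set ℬ_n. -/
/-- `betaElt T n l` is the element `β_n^l = u_1^{l_1} u_2^{l_2} ⋯ u_n^{l_n}`, where the
tuple `(l_1, …, l_n)` is encoded as `l : Fin n → ℕ` (so `l i` is `l_{i+1}`). -/
def betaElt {A : Type*} [Monoid A] (T : ℕ → A) (n : ℕ) (l : Fin n → ℕ) : A :=
  (List.ofFn fun i : Fin n => uElt T (i.1 + 1) (l i)).prod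

/-- The set `ℬ_n = {β_n^l : l ∈ ℒ_n}`, where `ℒ_n` is the set of tuples `(l_1, …, l_n)`
with `0 ≤ l_j ≤ j` for each `j`. -/
def heckeBasisSet {A : Type*} [Monoid A] (T : ℕ → A) (n : ℕ) : Set A :=
  {a : A | ∃ l : Fin n → ℕ, (∀ i : Fin n, l i ≤ i.1 + 1) ∧ a = betaElt T n l}

theorem uElt_zero' {A : Type*} [Monoid A] (T : ℕ → A) (i : ℕ) : uElt T i 0 = 1 := by
  simp [uElt]

theorem uElt_succ' {A : Type*} [Monoid A] (T : ℕ → A) (i s : ℕ) :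
    uElt T i (s + 1) = uElt T i s * T (i - s) := by
  simp [uElt, List.range_succ]

theorem betaElt_succ' {A : Type*} [Monoid A] (T : ℕ → A) (m : ℕ) (l : Fin (m + 1) → ℕ) :
    betaElt T (m + 1) l =
      betaElt T m (fun i => l i.castSucc) * uElt T (m + 1) (l (Fin.last m)) := by
  simp only [betaElt]
  rw [List.ofFn_succ']
  simp

theorem uElt_comm' {A : Type*} [Monoid A] (T : ℕ → A) (n : ℕ)
    (hc : ∀ j k, 1 ≤ j → j + 2 ≤ k → k ≤ n → T j * T k = T k * T j)
    (i j : ℕ) (hi : i ≤ n) (hj : 1 ≤ j) :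
    ∀ s, j + s + 1 ≤ i → uElt T i s * T j = T j * uElt T i s := by
  intro s
  induction s with
  | zero => intro _; simp [uElt_zero']
  | succ s ih =>
    intro h
    rw [uElt_succ', mul_assoc, ← hc j (i - s) hj (by omega) (by omega), ← mul_assoc,
      ih (by omega), mul_assoc]

theorem uElt_shift' {A : Type*} [Monoid A] (T : ℕ → A) (n : ℕ)
    (hc : ∀ j k, 1 ≤ j → j + 2 ≤ k → k ≤ n → T j * T k = T k * T j)
    (hb : ∀ j, 1 ≤ j → j + 1 ≤ n → T j * T (j + 1) * T j = T (j + 1) * T j * T (j + 1))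
    (i j : ℕ) (hi : i ≤ n) (hj : j + 1 ≤ i) :
    ∀ s, s ≤ i → i + 1 ≤ j + s → uElt T i s * T (j + 1) = T j * uElt T i s := by
  intro s
  induction s with
  | zero => intro _ _; omega
  | succ s ih =>
    intro h1 h2
    by_cases h : i + 1 ≤ j + s
    · rw [uElt_succ', mul_assoc, hc (i - s) (j + 1) (by omega) (by omega) (by omega),
        ← mul_assoc, ih (by omega) h, mul_assoc]
    · obtain ⟨t, rfl⟩ : ∃ t, s = t + 1 := ⟨s - 1, by omega⟩
      have e1 : i - t = j + 1 := by omega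
      have e2 : i - (t + 1) = j := by omega
      have hcm := uElt_comm' T n hc i j hi (by omega) t (by omega)
      have hbr := hb j (by omega) (by omega)
      rw [uElt_succ', uElt_succ', e1, e2]
      calc uElt T i t * T (j + 1) * T j * T (j + 1)
          = uElt T i t * (T (j + 1) * T j * T (j + 1)) := by simp only [mul_assoc]
        _ = uElt T i t * T j * (T (j + 1) * T j) := by rw [← hbr]; simp only [mul_assoc]
        _ = _ := by rw [hcm]; simp only [mul_assoc]

theorem span_mul_u' {K : Type*} [Field K] {A : Type*} [Ring A] [Algebra K A] (T : ℕ → A)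
    (m s : ℕ) (hs : s ≤ m + 1) (v : A) (hv : v ∈ Submodule.span K (heckeBasisSet T m)) :
    v * uElt T (m + 1) s ∈ Submodule.span K (heckeBasisSet T (m + 1)) := by
  induction hv using Submodule.span_induction with
  | mem x hx =>
    obtain ⟨l, hl, rfl⟩ := hx
    apply Submodule.subset_span
    refine ⟨Fin.snoc (α := fun _ => ℕ) l s, ?_, ?_⟩
    · intro i
      refine Fin.lastCases ?_ (fun i => ?_) i
      · simpa using hs
      · simpa using hl i
    · rw [betaElt_succ']
      simp
  | zero => simp
  | add x y _ _ hx hy => rw [add_mul]; exact Submodule.add_mem _ hx hy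
  | smul a x _ hx => rw [smul_mul_assoc]; exact Submodule.smul_mem _ _ hx

theorem span_mul_T' {K : Type*} [Field K] (q : K) {A : Type*} [Ring A] [Algebra K A]
    (T : ℕ → A) (n : ℕ)
    (hc : ∀ j k, 1 ≤ j → j + 2 ≤ k → k ≤ n → T j * T k = T k * T j)
    (hb : ∀ j, 1 ≤ j → j + 1 ≤ n → T j * T (j + 1) * T j = T (j + 1) * T j * T (j + 1))
    (hquad : ∀ j, 1 ≤ j → j ≤ n → T j ^ 2 = (q - 1) • T j + q • (1 : A)) :
    ∀ m, m ≤ n → ∀ j, 1 ≤ j → j ≤ m → ∀ v ∈ Submodule.span K (heckeBasisSet T m),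
      v * T j ∈ Submodule.span K (heckeBasisSet T m) := by
  intro m
  induction m with
  | zero => intros; omega
  | succ m ih =>
    intro hm j hj1 hjm v hv
    induction hv using Submodule.span_induction with
    | zero => simp
    | add x y _ _ hx hy => rw [add_mul]; exact Submodule.add_mem _ hx hy
    | smul a x _ hx => rw [smul_mul_assoc]; exact Submodule.smul_mem _ _ hx
    | mem x hx =>
      obtain ⟨l, hl, rfl⟩ := hx
      rw [betaElt_succ']
      have hs : l (Fin.last m) ≤ m + 1 := by simpa using hl (Fin.last m)
      have hw : betaElt T m (fun i => l i.castSucc) ∈ Submodule.span K (heckeBasisSet T m) :=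
        Submodule.subset_span ⟨_, fun i => by simpa using hl i.castSucc, rfl⟩
      generalize betaElt T m (fun i => l i.castSucc) = w at hw
      generalize l (Fin.last m) = s at hs
      rw [mul_assoc]
      rcases lt_or_ge (j + s) (m + 1) with h | h
      · rw [uElt_comm' T n hc (m + 1) j hm hj1 s (by omega), ← mul_assoc]
        exact span_mul_u' T m s hs _ (ih (by omega) j hj1 (by omega) w hw)
      rcases h.eq_or_lt with h | h
      · have e : j = m + 1 - s := by omega
        rw [e, ← uElt_succ']
        exact span_mul_u' T m (s + 1) (by omega) _ hw
      by_cases h' : j + s = m + 2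
      · obtain ⟨t, rfl⟩ : ∃ t, s = t + 1 := ⟨s - 1, by omega⟩
        have e : m + 1 - t = j := by omega
        have key : w * (uElt T (m + 1) (t + 1) * T j) =
            (q - 1) • (w * uElt T (m + 1) (t + 1)) + q • (w * uElt T (m + 1) t) := by
          rw [uElt_succ', e, mul_assoc, ← pow_two, hquad j hj1 (by omega)]
          simp only [mul_add, mul_smul_comm, mul_one]
        rw [key]
        exact Submodule.add_mem _
          (Submodule.smul_mem _ _ (span_mul_u' T m (t + 1) hs _ hw))
          (Submodule.smul_mem _ _ (span_mul_u' T m t (by omega) _ hw))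
      · obtain ⟨k, rfl⟩ : ∃ k, j = k + 1 := ⟨j - 1, by omega⟩
        rw [uElt_shift' T n hc hb (m + 1) k hm hjm s hs (by omega), ← mul_assoc]
        exact span_mul_u' T m s hs _ (ih (by omega) k (by omega) (by omega) w hw)

theorem betaL_mul_u_mem_span {K : Type*} [Field K] (q : K)
    {A : Type*} [Ring A] [Algebra K A] (n : ℕ) (T : ℕ → A)
    (hcomm : ∀ j k, 1 ≤ j → j ≤ n → 1 ≤ k → k ≤ n → 2 ≤ |(j : ℤ) - (k : ℤ)| →
      T j * T k = T k * T j)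
    (hbraid : ∀ j, 1 ≤ j → j + 1 ≤ n →
      T j * T (j + 1) * T j = T (j + 1) * T j * T (j + 1))
    (hquad : ∀ j, 1 ≤ j → j ≤ n → T j ^ 2 = (q - 1) • T j + q • (1 : A))
    (l : Fin n → ℕ) (hl : ∀ i : Fin n, l i ≤ i.1 + 1)
    (s : ℕ) (hs : s ≤ n) :
    betaElt T n l * uElt T n s ∈ Submodule.span K (heckeBasisSet T n) := by
  have hc : ∀ j k, 1 ≤ j → j + 2 ≤ k → k ≤ n → T j * T k = T k * T j := by
    intro j k h1 h2 h3
    refine hcomm j k h1 (by omega) (by omega) h3 ?_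
    rw [abs_sub_comm]
    exact le_trans (by omega) (le_abs_self _)
  induction s with
  | zero =>
    rw [uElt_zero', mul_one]
    exact Submodule.subset_span ⟨l, hl, rfl⟩
  | succ s ih =>
    rw [uElt_succ', ← mul_assoc]
    exact span_mul_T' q T n hc hbraid hquad n le_rfl (n - s) (by omega) (by omega) _
      (ih (by omega))
end

section
/- Assume q ≠ 0, so that each T_j is invertible with T_j^{-1} = q^{-1}·(T_j + (1-q)·1). Let δ = 1 if n is odd and δ = -1 if n is even, let d = 1 if n is odd and d = 0 if n is even, and let r = (n-d)/2. Then T_1 · T_2^{-1} · T_3 · T_4^{-1} ⋯ T_n^{δ} = q^{-r} · Σ_{l ∈ 𝒩_n} (1-q)^{n - (l_1 + l_2 + ⋯ + l_n)} · β_n^l. -/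
/-- The index set `𝒩_n`. -/
def nSet (n : ℕ) : Finset (Fin n → ℕ) :=
  (Fintype.piFinset fun _ : Fin n => Finset.range 2).filter
            (fun l : Fin n → ℕ => ∀ i : Fin n, Odd (i.1 + 1) → l i = 1)

lemma nSet_sum_le {n : ℕ} {l : Fin n → ℕ} (h : l ∈ nSet n) : ∑ i : Fin n, l i ≤ n := by
  have h1 : ∀ i ∈ (Finset.univ : Finset (Fin n)), l i ≤ 1 := by
    intro i _
    simp only [nSet, Finset.mem_filter, Fintype.mem_piFinset, Finset.mem_range] at h
    have := h.1 i
    omega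
  simpa using Finset.sum_le_card_nsmul _ _ _ h1

lemma snoc_mem_nSet {n : ℕ} (l : Fin n → ℕ) (a : ℕ) :
    (Fin.snoc l a : Fin (n + 1) → ℕ) ∈ nSet (n + 1) ↔
      l ∈ nSet n ∧ a ∈ (if Odd (n + 1) then {1} else Finset.range 2 : Finset ℕ) := by
  simp only [nSet, Finset.mem_filter, Fintype.mem_piFinset, Finset.mem_range,
    Fin.forall_fin_succ', Fin.snoc_castSucc, Fin.snoc_last, Fin.val_castSucc, Fin.val_last]
  split_ifs with h
  · simp only [h, Finset.mem_singleton, true_imp_iff]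
    constructor
    · tauto
    · rintro ⟨⟨h1, h2⟩, rfl⟩
      exact ⟨⟨h1, by norm_num⟩, h2, rfl⟩
  · simp only [h, Finset.mem_range]
    tauto

lemma sum_nSet_succ {A : Type*} [AddCommMonoid A] (n : ℕ) (f : (Fin (n + 1) → ℕ) → A) :
    ∑ l ∈ nSet (n + 1), f l = ∑ l ∈ nSet n,
      ∑ a ∈ (if Odd (n + 1) then {1} else Finset.range 2 : Finset ℕ), f (Fin.snoc l a) := by
  rw [← Finset.sum_product']
  refine Finset.sum_nbij' (fun l => (Fin.init l, l (Fin.last n)))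
    (fun p => (Fin.snoc p.1 p.2 : Fin (n + 1) → ℕ)) ?_ ?_ ?_ ?_ ?_
  · intro l hl
    rw [← Fin.snoc_init_self l, snoc_mem_nSet] at hl
    exact Finset.mem_product.2 hl
  · intro p hp
    exact (snoc_mem_nSet _ _).2 (Finset.mem_product.1 hp)
  · intro l _
    exact Fin.snoc_init_self l
  · intro p _
    simp
  · intro l _
    simp

lemma betaElt_snoc {A : Type*} [Monoid A] (T : ℕ → A) (n : ℕ) (l : Fin n → ℕ) (a : ℕ) :
    betaElt T (n + 1) (Fin.snoc l a) = betaElt T n l * uElt T (n + 1) a := by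
  rw [betaElt, List.ofFn_succ', List.concat_eq_append, List.prod_append]
  simp [betaElt]

lemma nSum_succ {K : Type*} [Field K] (q : K) {A : Type*} [Ring A] [Algebra K A] (n : ℕ)
    (T : ℕ → A) :
    ∑ l ∈ nSet (n + 1), ((1 - q) ^ (n + 1 - ∑ i : Fin (n + 1), l i)) • betaElt T (n + 1) l =
    (∑ l ∈ nSet n, ((1 - q) ^ (n - ∑ i : Fin n, l i)) • betaElt T n l) *
      (if Odd (n + 1) then T (n + 1) else T (n + 1) + (1 - q) • (1 : A)) := by
  rw [sum_nSet_succ, Finset.sum_mul]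
  refine Finset.sum_congr rfl fun l hl => ?_
  have hle := nSet_sum_le hl
  have e1 : n + 1 - (∑ i : Fin n, l i + 1) = n - ∑ i : Fin n, l i := by omega
  have e0 : n + 1 - (∑ i : Fin n, l i) = (n - ∑ i : Fin n, l i) + 1 := by omega
  split_ifs with h
  · simp [Fin.sum_univ_castSucc, betaElt_snoc, uElt, e1]
  · simp only [Finset.sum_range_succ, Finset.sum_range_zero, Fin.sum_univ_castSucc, betaElt_snoc,
      Fin.snoc_castSucc, Fin.snoc_last, e1, e0, zero_add, add_zero]
    simp [uElt, mul_add, pow_succ, mul_smul, add_comm]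
    exact smul_comm _ _ _

lemma half_exp (n : ℕ) : ((n - (if Odd n then 1 else 0)) / 2 : ℕ) = n / 2 := by
  split_ifs with h
  · obtain ⟨k, rfl⟩ := h
    omega
  · rfl

lemma weaving_aux {K : Type*} [Field K] (q : K) (hq : q ≠ 0) {A : Type*} [Ring A] [Algebra K A]
    (T : ℕ → A) (n : ℕ) :
    ((List.range n).map fun j =>
        if Odd (j + 1) then T (j + 1) else q⁻¹ • (T (j + 1) + (1 - q) • (1 : A))).prod =
      (q⁻¹ ^ (n / 2)) •
        ∑ l ∈ nSet n, ((1 - q) ^ (n - ∑ i : Fin n, l i)) • betaElt T n l := by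
  induction n with
  | zero =>
    have : nSet 0 = {Fin.elim0} := by
      ext l
      simp [nSet, eq_iff_true_of_subsingleton]
    simp [this, betaElt]
  | succ n ih =>
    rw [List.range_succ, List.map_append, List.prod_append, ih, nSum_succ]
    simp only [List.map_cons, List.map_nil, List.prod_cons, List.prod_nil, mul_one]
    split_ifs with h
    · have : (n + 1) / 2 = n / 2 := by
        obtain ⟨k, hk⟩ := h
        omega
      rw [this, smul_mul_assoc]
    · have : (n + 1) / 2 = n / 2 + 1 := by
        obtain ⟨k, hk⟩ := Nat.not_odd_iff_even.1 h
        omega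
      rw [this, pow_succ, smul_mul_assoc, mul_smul_comm, mul_smul]

theorem weaving_element_expansion {K : Type*} [Field K] (q : K) (hq : q ≠ 0)
    {A : Type*} [Ring A] [Algebra K A] (n : ℕ) (T : ℕ → A)
    (hcomm : ∀ j k, 1 ≤ j → j ≤ n → 1 ≤ k → k ≤ n → 2 ≤ |(j : ℤ) - (k : ℤ)| →
      T j * T k = T k * T j)
    (hbraid : ∀ j, 1 ≤ j → j + 1 ≤ n →
      T j * T (j + 1) * T j = T (j + 1) * T j * T (j + 1))
    (hquad : ∀ j, 1 ≤ j → j ≤ n → T j ^ 2 = (q - 1) • T j + q • (1 : A)) :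
    ((List.range n).map fun j =>
        if Odd (j + 1) then T (j + 1) else q⁻¹ • (T (j + 1) + (1 - q) • (1 : A))).prod =
      (q ^ (-(((n - (if Odd n then 1 else 0)) / 2 : ℕ) : ℤ))) •
        ∑ l ∈ (Fintype.piFinset fun _ : Fin n => Finset.range 2).filter
            (fun l : Fin n → ℕ => ∀ i : Fin n, Odd (i.1 + 1) → l i = 1),
          ((1 - q) ^ (n - ∑ i : Fin n, l i)) • betaElt T n l := by
  rw [half_exp, zpow_neg, zpow_natCast, ← inv_pow]
  exact weaving_aux q hq T n
end

section
/- For every finite list of indices (i_1, i_2, …, i_L) with each i_k ∈ {1, …, n}, the polynomial Tr(T_{i_1} T_{i_2} ⋯ T_{i_L}) ∈ R is nonzero and its total degree equals L, the length of the word. -/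
/-- The polynomial ring `ℚ[q, z]` in two variables. -/
abbrev HeckeCoeffRing : Type := MvPolynomial (Fin 2) ℚ

/-- The variable `q` of `ℚ[q, z]`. -/
noncomputable def qVar : HeckeCoeffRing := MvPolynomial.X 0

/-- The variable `z` of `ℚ[q, z]`. -/
noncomputable def zVar : HeckeCoeffRing := MvPolynomial.X 1

/-- `r` has only terms of total degree below `L`. -/
def LowDeg (L : ℕ) (r : HeckeCoeffRing) : Prop := r = 0 ∨ r.totalDegree < L

/-- `f` is a monomial `q^a z^b` of degree `L` plus lower terms. -/
def TopMono (L : ℕ) (f : HeckeCoeffRing) : Prop :=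
  ∃ a b r, a + b = L ∧ LowDeg L r ∧ f = qVar ^ a * zVar ^ b + r

theorem LowDeg.add {L : ℕ} {r s : HeckeCoeffRing} (hr : LowDeg L r) (hs : LowDeg L s) :
    LowDeg L (r + s) := by
  rcases hr with rfl | hr
  · simpa using hs
  rcases hs with rfl | hs
  · right; simpa using hr
  · right; exact lt_of_le_of_lt (MvPolynomial.totalDegree_add r s) (max_lt hr hs)

theorem LowDeg.neg {L : ℕ} {r : HeckeCoeffRing} (hr : LowDeg L r) : LowDeg L (-r) := by
  rcases hr with rfl | hr
  · left; simp
  · right; rwa [MvPolynomial.totalDegree_neg]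

theorem LowDeg.X_mul {L : ℕ} {r : HeckeCoeffRing} (i : Fin 2) (hr : LowDeg L r) :
    LowDeg (L + 1) (MvPolynomial.X i * r) := by
  rcases hr with rfl | hr
  · left; simp
  · right
    have := MvPolynomial.totalDegree_mul (MvPolynomial.X i : HeckeCoeffRing) r
    rw [MvPolynomial.totalDegree_X] at this
    omega

theorem LowDeg.mono {L M : ℕ} {r : HeckeCoeffRing} (hr : LowDeg L r) (h : L ≤ M) :
    LowDeg M r := by
  rcases hr with rfl | hr
  · left; rfl
  · right; omega

theorem totalDegree_qz (a b : ℕ) : (qVar ^ a * zVar ^ b).totalDegree = a + b := by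
  unfold qVar zVar
  rw [MvPolynomial.totalDegree_mul_of_isDomain (pow_ne_zero _ (MvPolynomial.X_ne_zero _))
    (pow_ne_zero _ (MvPolynomial.X_ne_zero _)), MvPolynomial.totalDegree_X_pow,
    MvPolynomial.totalDegree_X_pow]

theorem qz_ne_zero (a b : ℕ) : (qVar ^ a * zVar ^ b) ≠ 0 :=
  mul_ne_zero (pow_ne_zero _ (MvPolynomial.X_ne_zero _)) (pow_ne_zero _ (MvPolynomial.X_ne_zero _))

theorem TopMono.low {L M : ℕ} {f : HeckeCoeffRing} (hf : TopMono L f) (h : L < M) :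
    LowDeg M f := by
  obtain ⟨a, b, r, hab, hr, rfl⟩ := hf
  refine LowDeg.add (Or.inr ?_) (hr.mono h.le)
  rw [totalDegree_qz]; omega

theorem TopMono.q_mul {L : ℕ} {f : HeckeCoeffRing} (hf : TopMono L f) :
    TopMono (L + 1) (qVar * f) := by
  obtain ⟨a, b, r, hab, hr, rfl⟩ := hf
  exact ⟨a + 1, b, qVar * r, by omega, hr.X_mul 0, by ring⟩

theorem TopMono.z_mul {L : ℕ} {f : HeckeCoeffRing} (hf : TopMono L f) :
    TopMono (L + 1) (zVar * f) := by
  obtain ⟨a, b, r, hab, hr, rfl⟩ := hf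
  exact ⟨a, b + 1, zVar * r, by omega, hr.X_mul 1, by ring⟩

theorem TopMono.add_low {L : ℕ} {f g : HeckeCoeffRing} (hf : TopMono L f) (hg : LowDeg L g) :
    TopMono L (f + g) := by
  obtain ⟨a, b, r, hab, hr, rfl⟩ := hf
  exact ⟨a, b, r + g, hab, hr.add hg, by ring⟩

theorem TopMono.final {L : ℕ} {f : HeckeCoeffRing} (hf : TopMono L f) :
    f ≠ 0 ∧ f.totalDegree = L := by
  obtain ⟨a, b, r, rfl, hr, rfl⟩ := hf
  rcases hr with rfl | hr
  · rw [add_zero]; exact ⟨qz_ne_zero a b, totalDegree_qz a b⟩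
  · have h : (qVar ^ a * zVar ^ b + r).totalDegree = a + b := by
      rw [MvPolynomial.totalDegree_add_eq_left_of_totalDegree_lt, totalDegree_qz]
      rwa [totalDegree_qz]
    refine ⟨?_, h⟩
    intro h0
    rw [h0, MvPolynomial.totalDegree_zero] at h
    omega

/-- All letters of `w` lie in `1..m`. -/
def WordIn (m : ℕ) (w : List ℕ) : Prop := ∀ x ∈ w, 1 ≤ x ∧ x ≤ m

theorem WordIn.mono {m k : ℕ} {w : List ℕ} (h : WordIn m w) (hk : m ≤ k) : WordIn k w :=
  fun x hx => ⟨(h x hx).1, (h x hx).2.trans hk⟩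

theorem wordIn_append {m : ℕ} {u v : List ℕ} :
    WordIn m (u ++ v) ↔ WordIn m u ∧ WordIn m v := by
  simp only [WordIn, List.mem_append]
  constructor
  · exact fun h => ⟨fun x hx => h x (Or.inl hx), fun x hx => h x (Or.inr hx)⟩
  · rintro ⟨h1, h2⟩ x (hx | hx)
    exacts [h1 x hx, h2 x hx]

theorem wordIn_cons {m x : ℕ} {v : List ℕ} :
    WordIn m (x :: v) ↔ (1 ≤ x ∧ x ≤ m) ∧ WordIn m v := by
  simp [WordIn]

theorem wordIn_nil {m : ℕ} : WordIn m [] := by simp [WordIn]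

/-- The product of a word. -/
def wprod {A : Type*} [Ring A] (T : ℕ → A) (w : List ℕ) : A := (w.map T).prod

theorem wprod_append {A : Type*} [Ring A] (T : ℕ → A) (u v : List ℕ) :
    wprod T (u ++ v) = wprod T u * wprod T v := by simp [wprod]

theorem wprod_cons {A : Type*} [Ring A] (T : ℕ → A) (x : ℕ) (v : List ℕ) :
    wprod T (x :: v) = T x * wprod T v := by simp [wprod]

theorem wprod_nil {A : Type*} [Ring A] (T : ℕ → A) : wprod T [] = 1 := by simp [wprod]

theorem wprod_comm {A : Type*} [Ring A] (T : ℕ → A) (n : ℕ)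
    (hcomm : ∀ j k, 1 ≤ j → j ≤ n → 1 ≤ k → k ≤ n → 2 ≤ |(j : ℤ) - (k : ℤ)| →
      T j * T k = T k * T j) (m : ℕ) (hm : m + 2 ≤ n) (w : List ℕ) (hw : WordIn m w) :
    T (m + 2) * wprod T w = wprod T w * T (m + 2) := by
  induction w with
  | nil => simp [wprod]
  | cons x w ih =>
    rw [wordIn_cons] at hw
    have h : T (m + 2) * T x = T x * T (m + 2) := by
      apply hcomm <;> try omega
      rw [abs_of_nonneg] <;> push_cast <;> omega
    rw [wprod_cons, ← mul_assoc, h, mul_assoc, ih hw.2, mul_assoc]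

/-- Normal form of a word. -/
theorem word_cases {A : Type*} [Ring A] (T : ℕ → A) (n : ℕ)
    (hcomm : ∀ j k, 1 ≤ j → j ≤ n → 1 ≤ k → k ≤ n → 2 ≤ |(j : ℤ) - (k : ℤ)| →
      T j * T k = T k * T j)
    (hbraid : ∀ j, 1 ≤ j → j + 1 ≤ n →
      T j * T (j + 1) * T j = T (j + 1) * T j * T (j + 1)) (m : ℕ) :
    m + 1 ≤ n → ∀ w : List ℕ, WordIn (m + 1) w →
      (∃ u j v, WordIn (m + 1) u ∧ (1 ≤ j ∧ j ≤ m + 1) ∧ WordIn (m + 1) v ∧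
        w.length = u.length + v.length + 2 ∧
        wprod T w = wprod T u * T j * T j * wprod T v) ∨
      (∃ w', WordIn m w' ∧ w.length = w'.length ∧ wprod T w = wprod T w') ∨
      (∃ a b, WordIn m a ∧ WordIn m b ∧ w.length = a.length + b.length + 1 ∧
        wprod T w = wprod T a * T (m + 1) * wprod T b) := by
  induction m with
  | zero =>
    intro hm w
    induction w with
    | nil => exact fun _ => Or.inr (Or.inl ⟨[], wordIn_nil, rfl, rfl⟩)
    | cons x w ih =>
      intro hw
      rw [wordIn_cons] at hw
      obtain ⟨hx, hw⟩ := hw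
      have hx1 : x = 1 := by omega
      subst hx1
      cases w with
      | nil => exact Or.inr (Or.inr ⟨[], [], wordIn_nil, wordIn_nil, rfl, by simp [wprod]⟩)
      | cons y w =>
        rw [wordIn_cons] at hw
        have hy1 : y = 1 := by omega
        subst hy1
        exact Or.inl ⟨[], 1, w, wordIn_nil, by omega, hw.2, by simp, by simp [wprod, mul_assoc]⟩
  | succ m IH =>
    intro hm w
    induction w with
    | nil => exact fun _ => Or.inr (Or.inl ⟨[], wordIn_nil, rfl, rfl⟩)
    | cons x w ih =>
      intro hw
      rw [wordIn_cons] at hw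
      obtain ⟨hx, hw⟩ := hw
      rcases ih hw with ⟨u, j, v, hu, hj, hv, hl, hp⟩ | ⟨w', hw', hl, hp⟩ | ⟨a, b, ha, hb, hl, hp⟩
      · refine Or.inl ⟨x :: u, j, v, wordIn_cons.2 ⟨hx, hu⟩, hj, hv, ?_, ?_⟩
        · simp only [List.length_cons]; omega
        · simp only [wprod_cons, hp, mul_assoc]
      · by_cases hxm : x ≤ m + 1
        · refine Or.inr (Or.inl ⟨x :: w', wordIn_cons.2 ⟨⟨hx.1, hxm⟩, hw'⟩, ?_, ?_⟩)
          · simp only [List.length_cons]; omega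
          · simp only [wprod_cons, hp]
        · have hx2 : x = m + 1 + 1 := by omega
          subst hx2
          refine Or.inr (Or.inr ⟨[], w', wordIn_nil, hw', ?_, ?_⟩)
          · simp only [List.length_cons, List.length_nil]; omega
          · simp only [wprod_cons, hp, wprod_nil, one_mul]
      · by_cases hxm : x ≤ m + 1
        · refine Or.inr (Or.inr ⟨x :: a, b, wordIn_cons.2 ⟨⟨hx.1, hxm⟩, ha⟩, hb, ?_, ?_⟩)
          · simp only [List.length_cons]; omega
          · simp only [wprod_cons, hp, mul_assoc]
        · have hx2 : x = m + 2 := by omega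
          subst hx2
          rcases IH (by omega) a ha with ⟨u, j, v, hu, hj, hv, hl', hp'⟩ | ⟨a', ha', hl', hp'⟩ |
            ⟨c, d, hc, hd, hl', hp'⟩
          · refine Or.inl ⟨(m + 2) :: u, j, v ++ (m + 2) :: b,
              wordIn_cons.2 ⟨hx, hu.mono (by omega)⟩, by omega,
              wordIn_append.2 ⟨hv.mono (by omega), wordIn_cons.2 ⟨hx, hb.mono (by omega)⟩⟩, ?_, ?_⟩
            · simp only [List.length_cons, List.length_append]; omega
            · simp only [wprod_cons, wprod_append, hp, hp', mul_assoc]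
          · refine Or.inl ⟨a', m + 2, b, ha'.mono (by omega), by omega, hb.mono (by omega), ?_, ?_⟩
            · simp only [List.length_cons]; omega
            · have h := wprod_comm T n hcomm m hm a' ha'
              calc wprod T ((m + 2) :: w) = (T (m + 2) * wprod T a') * T (m + 2) * wprod T b := by
                    rw [wprod_cons, hp, hp']; simp only [mul_assoc]
                _ = _ := by rw [h]
          · refine Or.inr (Or.inr ⟨c ++ [m + 1], (m + 1) :: (d ++ b), ?_, ?_, ?_, ?_⟩)
            · exact wordIn_append.2 ⟨hc.mono (by omega), wordIn_cons.2 ⟨by omega, wordIn_nil⟩⟩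
            · exact wordIn_cons.2 ⟨by omega, wordIn_append.2 ⟨hd.mono (by omega), hb⟩⟩
            · simp only [List.length_cons, List.length_append, List.length_nil]; omega
            · have h1 := wprod_comm T n hcomm m hm c hc
              have h2 := wprod_comm T n hcomm m hm d hd
              have h3 := hbraid (m + 1) (by omega) (by omega)
              simp only [wprod_cons, wprod_append, wprod_nil, mul_one, hp, hp']
              calc T (m + 2) * (wprod T c * T (m + 1) * wprod T d * T (m + 2) * wprod T b)
                  = (T (m + 2) * wprod T c) * T (m + 1) * (wprod T d * T (m + 2)) * wprod T b := by
                    simp only [mul_assoc]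
                _ = wprod T c * (T (m + 1 + 1) * T (m + 1) * T (m + 1 + 1))
                      * wprod T d * wprod T b := by
                    rw [h1, ← h2]; simp only [mul_assoc]
                _ = _ := by rw [← h3]; simp only [mul_assoc]

theorem wprod_mem_adjoin {A : Type*} [Ring A] [Algebra HeckeCoeffRing A] (T : ℕ → A) (m : ℕ)
    (w : List ℕ) (hw : WordIn m w) :
    wprod T w ∈ Algebra.adjoin HeckeCoeffRing {x : A | ∃ j, 1 ≤ j ∧ j < m + 1 ∧ x = T j} := by
  induction w with
  | nil => rw [wprod_nil]; exact one_mem _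
  | cons x w ih =>
    rw [wordIn_cons] at hw
    rw [wprod_cons]
    exact mul_mem (Algebra.subset_adjoin ⟨x, hw.1.1, by omega, rfl⟩) (ih hw.2)

theorem trace_word_totalDegree {A : Type*} [Ring A] [Algebra HeckeCoeffRing A]
    (n : ℕ) (T : ℕ → A)
    (hcomm : ∀ j k, 1 ≤ j → j ≤ n → 1 ≤ k → k ≤ n → 2 ≤ |(j : ℤ) - (k : ℤ)| →
      T j * T k = T k * T j)
    (hbraid : ∀ j, 1 ≤ j → j + 1 ≤ n →
      T j * T (j + 1) * T j = T (j + 1) * T j * T (j + 1))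
    (hquad : ∀ j, 1 ≤ j → j ≤ n → T j ^ 2 = (qVar - 1) • T j + qVar • (1 : A))
    (Tr : A →ₗ[HeckeCoeffRing] HeckeCoeffRing)
    (hTr1 : Tr 1 = 1)
    (hTrcomm : ∀ a b : A, Tr (a * b) = Tr (b * a))
    (hTrz : ∀ i, 1 ≤ i → i ≤ n → ∀ a b : A,
      a ∈ Algebra.adjoin HeckeCoeffRing {x : A | ∃ j, 1 ≤ j ∧ j < i ∧ x = T j} →
      b ∈ Algebra.adjoin HeckeCoeffRing {x : A | ∃ j, 1 ≤ j ∧ j < i ∧ x = T j} →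
      Tr (a * T i * b) = zVar * Tr (a * b))
    (L : ℕ) (is : Fin L → ℕ) (his : ∀ t, 1 ≤ is t ∧ is t ≤ n) :
    Tr (List.ofFn fun t => T (is t)).prod ≠ 0 ∧
      (Tr (List.ofFn fun t => T (is t)).prod).totalDegree = L := by
  have key : ∀ L : ℕ, ∀ m : ℕ, m ≤ n → ∀ w : List ℕ, WordIn m w → w.length = L →
      TopMono L (Tr (wprod T w)) := by
    intro L
    induction L using Nat.strong_induction_on with
    | _ L IH =>
    intro m
    induction m with
    | zero =>
      intro _ w hw hl
      cases w with
      | nil =>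
        subst hl
        rw [wprod_nil, hTr1]
        exact ⟨0, 0, 0, rfl, Or.inl rfl, by simp⟩
      | cons x w =>
        rw [wordIn_cons] at hw
        omega
    | succ m ih =>
      intro hm w hw hl
      rcases word_cases T n hcomm hbraid m hm w hw with ⟨u, j, v, hu, hj, hv, hl', hp⟩ |
        ⟨w', hw', hl', hp⟩ | ⟨a, b, ha, hb, hl', hp⟩
      · have h1 := IH (u.length + v.length + 1) (by omega) (m + 1) hm (u ++ j :: v)
          (wordIn_append.2 ⟨hu, wordIn_cons.2 ⟨hj, hv⟩⟩)
          (by simp only [List.length_append, List.length_cons]; omega)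
        have h2 := IH (u.length + v.length) (by omega) (m + 1) hm (u ++ v)
          (wordIn_append.2 ⟨hu, hv⟩) (by simp only [List.length_append])
        have e : Tr (wprod T w) = qVar * Tr (wprod T (u ++ j :: v)) +
            (-Tr (wprod T (u ++ j :: v)) + qVar * Tr (wprod T (u ++ v))) := by
          have hq := hquad j hj.1 (by omega)
          rw [hp, mul_assoc (wprod T u), ← pow_two, hq, wprod_append, wprod_append, wprod_cons]
          simp only [mul_add, add_mul, mul_smul_comm, smul_mul_assoc, map_add, map_smul,
            smul_eq_mul, mul_one, mul_assoc]
          ring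
        have hL : L = u.length + v.length + 1 + 1 := by omega
        rw [e, hL]
        exact h1.q_mul.add_low ((h1.low (by omega)).neg.add (h2.q_mul.low (by omega)))
      · rw [hp]
        exact ih (by omega) w' hw' (by omega)
      · rw [hp, hTrz (m + 1) (by omega) hm _ _ (wprod_mem_adjoin T m a ha)
          (wprod_mem_adjoin T m b hb), ← wprod_append]
        have h := IH (a.length + b.length) (by omega) m (by omega) (a ++ b)
          (wordIn_append.2 ⟨ha, hb⟩) (by simp only [List.length_append])
        have hL : L = a.length + b.length + 1 := by omega
        rw [hL]
        exact h.z_mul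
  have h := key L n le_rfl (List.ofFn is) (by
    intro x hx
    rw [List.mem_ofFn] at hx
    obtain ⟨t, rfl⟩ := hx
    exact his t) (by simp)
  have e : wprod T (List.ofFn is) = (List.ofFn fun t => T (is t)).prod := by
    rw [wprod, List.map_ofFn]; rfl
  rw [e] at h
  exact h.final
end

section
/- Let n ≥ 1 and m ≥ 1 be integers, let d = 1 if n is odd and d = 0 if n is even, and let r = (n-d)/2. Let γ = (T_1 · (T_2 + (1-q)·1) · T_3 · (T_4 + (1-q)·1) ⋯ F_n)^m ∈ A, where the last factor F_n is T_n if n is odd and T_n + (1-q)·1 if n is even (so that γ equals q^{mr} times the image of the weaving braid (σ_1 σ_2^{-1} σ_3 σ_4^{-1} ⋯ σ_n^{δ})^m in the Hecke algebra). Then the polynomial Tr(γ) ∈ R is nonzero and its total degree equals mn. -/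
open MvPolynomial

namespace Weaving

/-- All monomials have degree less than `d`. -/
def Low (d : ℕ) (p : HeckeCoeffRing) : Prop := ∀ m ∈ p.support, m.degree < d

/-- `p` has degree at most `d` with degree `d` part equal to `f`. -/
def Top (d : ℕ) (p f : HeckeCoeffRing) : Prop := f.IsHomogeneous d ∧ Low d (p - f)

lemma Low.add {d p r} (hp : Low d p) (hr : Low d r) : Low d (p + r) := by
  intro m hm
  rcases Finset.mem_union.1 (MvPolynomial.support_add hm) with h | h
  · exact hp m h
  · exact hr m h

lemma Low.zero {d} : Low d 0 := by
  intro m hm; simp at hm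

lemma Low.mono {d e p} (hp : Low d p) (h : d ≤ e) : Low e p :=
  fun m hm => (hp m hm).trans_le h

lemma deg_add (a b : Fin 2 →₀ ℕ) : (a + b).degree = a.degree + b.degree := by
  simp

lemma Low.mul {d e p r} (hp : Low d p) (hr : Low (e + 1) r) : Low (d + e) (p * r) := by
  intro m hm
  obtain ⟨a, ha, b, hb, rfl⟩ := Finset.mem_add.1 (MvPolynomial.support_mul p r hm)
  have h1 := hp a ha
  have h2 := hr b hb
  rw [deg_add]; omega

lemma hom_deg {d} {f : HeckeCoeffRing} (h : f.IsHomogeneous d) {m} (hm : m ∈ f.support) :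
    m.degree = d := by
  by_contra hne
  exact (MvPolynomial.mem_support_iff.1 hm) (h.coeff_eq_zero hne)

lemma hom_low {d} {f : HeckeCoeffRing} (h : f.IsHomogeneous d) : Low (d + 1) f := by
  intro m hm
  rw [hom_deg h hm]; omega

lemma Top.low {d p f} (h : Top d p f) : Low (d + 1) p := by
  have := (h.2.mono (Nat.le_succ d)).add (hom_low h.1)
  simpa using this

lemma Top.add {d p f p' f'} (h : Top d p f) (h' : Top d p' f') : Top d (p + p') (f + f') := by
  refine ⟨h.1.add h'.1, ?_⟩
  have : p + p' - (f + f') = (p - f) + (p' - f') := by ring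
  rw [this]; exact h.2.add h'.2

lemma Top.mul {d e p f p' f'} (h : Top d p f) (h' : Top e p' f') :
    Top (d + e) (p * p') (f * f') := by
  refine ⟨h.1.mul h'.1, ?_⟩
  have : p * p' - (f * f') = (p - f) * p' + (p' - f') * f := by ring
  rw [this]
  refine (h.2.mul h'.low).add ?_
  rw [add_comm d e]
  exact h'.2.mul (hom_low h.1)

lemma Top.of_hom {d f} (h : MvPolynomial.IsHomogeneous f d) : Top d f f :=
  ⟨h, by simpa using Low.zero⟩

lemma hom_q : qVar.IsHomogeneous 1 := MvPolynomial.isHomogeneous_X _ _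
lemma hom_z : zVar.IsHomogeneous 1 := MvPolynomial.isHomogeneous_X _ _
lemma top_q : Top 1 qVar qVar := Top.of_hom hom_q
lemma top_z : Top 1 zVar zVar := Top.of_hom hom_z
lemma top_one : Top 0 1 1 := Top.of_hom (MvPolynomial.isHomogeneous_one _ _)

lemma low_one : Low 1 1 := hom_low (MvPolynomial.isHomogeneous_one _ _)

lemma Low.neg {d p} (hp : Low d p) : Low d (-p) := by
  intro m hm
  exact hp m (by simpa using hm)

lemma top_q1 : Top 1 (qVar - 1) qVar := ⟨hom_q, by
  have : qVar - 1 - qVar = -1 := by ring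
  rw [this]; exact low_one.neg⟩

lemma top_1q : Top 1 (1 - qVar) (-qVar) := ⟨hom_q.neg, by
  have : 1 - qVar - -qVar = 1 := by ring
  rw [this]; exact low_one⟩

lemma Top.add_low {d p f r} (h : Top d p f) (hr : Low d r) : Top d (p + r) f := by
  refine ⟨h.1, ?_⟩
  have : p + r - f = p - f + r := by ring
  rw [this]; exact h.2.add hr

lemma Top.final {d p f} (h : Top d p f) (hf : f ≠ 0) : p ≠ 0 ∧ p.totalDegree = d := by
  obtain ⟨m, hm⟩ := MvPolynomial.support_nonempty.2 hf
  have hd := hom_deg h.1 hm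
  have hmp : m ∈ p.support := by
    have h1 : MvPolynomial.coeff m (p - f) = 0 := by
      by_contra hne
      have := h.2 m (MvPolynomial.mem_support_iff.2 hne)
      omega
    rw [MvPolynomial.coeff_sub] at h1
    rw [MvPolynomial.mem_support_iff] at hm ⊢
    rwa [sub_eq_zero.1 h1]
  refine ⟨fun h0 => by simp [h0] at hmp, le_antisymm ?_ ?_⟩
  · rw [MvPolynomial.totalDegree_eq]
    refine Finset.sup_le fun b hb => ?_
    have := h.low b hb
    rw [Finsupp.degree_eq_sum] at this
    rw [Finsupp.card_toMultiset, Finsupp.sum_fintype _ _ (by simp)]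
    exact Nat.lt_succ_iff.1 this
  · rw [← hd, Finsupp.degree_eq_sum]
    have := MvPolynomial.le_totalDegree hmp
    rwa [Finsupp.sum_fintype _ _ (by simp)] at this

structure Hyp {A : Type*} [Ring A] [Algebra HeckeCoeffRing A]
    (n : ℕ) (T : ℕ → A) (Tr : A →ₗ[HeckeCoeffRing] HeckeCoeffRing) : Prop where
  hcomm : ∀ j k, 1 ≤ j → j ≤ n → 1 ≤ k → k ≤ n → 2 ≤ |(j : ℤ) - (k : ℤ)| →
      T j * T k = T k * T j
  hbraid : ∀ j, 1 ≤ j → j + 1 ≤ n →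
      T j * T (j + 1) * T j = T (j + 1) * T j * T (j + 1)
  hquad : ∀ j, 1 ≤ j → j ≤ n → T j ^ 2 = (qVar - 1) • T j + qVar • (1 : A)
  hTr1 : Tr 1 = 1
  hTrz : ∀ i, 1 ≤ i → i ≤ n → ∀ a b : A,
      a ∈ Algebra.adjoin HeckeCoeffRing {x : A | ∃ j, 1 ≤ j ∧ j < i ∧ x = T j} →
      b ∈ Algebra.adjoin HeckeCoeffRing {x : A | ∃ j, 1 ≤ j ∧ j < i ∧ x = T j} →
      Tr (a * T i * b) = zVar * Tr (a * b)

/-- The product of a word. -/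
def pw {A : Type*} [Ring A] (T : ℕ → A) (w : List ℕ) : A := (w.map T).prod

structure Eqv {A : Type*} [Ring A] (T : ℕ → A) (w w' : List ℕ) : Prop where
  prod : pw T w = pw T w'
  len : w.length = w'.length
  supp : w.toFinset = w'.toFinset

section
variable {A : Type*} [Ring A] {T : ℕ → A}

lemma pw_append (u v : List ℕ) : pw T (u ++ v) = pw T u * pw T v := by simp [pw]
lemma pw_cons (j : ℕ) (v : List ℕ) : pw T (j :: v) = T j * pw T v := by simp [pw]
lemma pw_nil : pw T [] = 1 := by simp [pw]

lemma Eqv.trans {u v w : List ℕ} (h : Eqv T u v) (h' : Eqv T v w) : Eqv T u w :=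
  ⟨h.1.trans h'.1, h.2.trans h'.2, h.3.trans h'.3⟩

lemma Eqv.refl (u : List ℕ) : Eqv T u u := ⟨rfl, rfl, rfl⟩

lemma Eqv.mem {u v : List ℕ} (h : Eqv T u v) (j : ℕ) : j ∈ u ↔ j ∈ v := by
  rw [← List.mem_toFinset, h.3, List.mem_toFinset]

lemma Eqv.congr {u v : List ℕ} (a b : List ℕ) (h : Eqv T u v) :
    Eqv T (a ++ (u ++ b)) (a ++ (v ++ b)) :=
  ⟨by simp only [pw_append, h.1], by simp only [List.length_append, h.2],
    by simp only [List.toFinset_append, h.3]⟩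

lemma comm_word (k : ℕ) (x : List ℕ) (h : ∀ j ∈ x, T k * T j = T j * T k) :
    T k * pw T x = pw T x * T k := by
  induction x with
  | nil => simp [pw_nil]
  | cons j x ih =>
    rw [pw_cons, ← mul_assoc, h j (by simp), mul_assoc, ih fun j hj => h j (by simp [hj]),
      mul_assoc]
end

section
variable {A : Type*} [Ring A] [Algebra HeckeCoeffRing A] {n : ℕ} {T : ℕ → A}
  {Tr : A →ₗ[HeckeCoeffRing] HeckeCoeffRing}

lemma Hyp.far (H : Hyp n T Tr) {i j : ℕ} (hi : i + 1 ≤ n) (hj : 1 ≤ j) (hji : j < i) :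
    T (i + 1) * T j = T j * T (i + 1) := by
  refine H.hcomm _ _ (by omega) hi hj (by omega) ?_
  rw [abs_of_nonneg] <;> push_cast <;> omega

lemma Hyp.normal (H : Hyp n T Tr) (i : ℕ) (hi : i ≤ n) : ∀ w : List ℕ,
    (∀ j ∈ w, 1 ≤ j ∧ j ≤ i) →
    ∃ w', Eqv T w w' ∧ ((∃ a j b, w' = a ++ ([j, j] ++ b)) ∨ w'.count i ≤ 1) := by
  induction i with
  | zero =>
    intro w hw
    refine ⟨w, Eqv.refl w, Or.inr ?_⟩
    rw [List.count_eq_zero_of_not_mem]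
    · omega
    · intro h; have := hw _ h; omega
  | succ i ih =>
    have key : ∀ c, ∀ w : List ℕ, (∀ j ∈ w, 1 ≤ j ∧ j ≤ i + 1) → w.count (i+1) = c →
        ∃ w', Eqv T w w' ∧ ((∃ a j b, w' = a ++ ([j, j] ++ b)) ∨ w'.count (i+1) ≤ 1) := by
      intro c
      induction c using Nat.strong_induction_on with
      | _ c ihc =>
      intro w hw hc
      by_cases hc1 : c ≤ 1
      · exact ⟨w, Eqv.refl w, Or.inr (by omega)⟩
      have hm : (i+1) ∈ w := List.count_pos_iff.1 (by omega)
      obtain ⟨a, v, rfl, ha⟩ := List.eq_append_cons_of_mem hm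
      have ha0 := List.count_eq_zero_of_not_mem ha
      rw [List.count_append, List.count_cons_self, ha0] at hc
      have hm : (i+1) ∈ v := List.count_pos_iff.1 (by omega)
      obtain ⟨u, b, rfl, hu⟩ := List.eq_append_cons_of_mem hm
      have hu0 := List.count_eq_zero_of_not_mem hu
      have hub : ∀ j ∈ u, 1 ≤ j ∧ j ≤ i := by
        intro j hj
        have h1 := hw j (by simp [hj])
        have h2 : j ≠ i + 1 := fun h => hu (h ▸ hj)
        omega
      obtain ⟨u', hE, hu'⟩ := ih (by omega) u hub
      have hub' : ∀ j ∈ u', 1 ≤ j ∧ j ≤ i := fun j hj => hub j ((hE.mem j).2 hj)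
      have hE1 : Eqv T (a ++ (i+1) :: (u ++ (i+1) :: b)) (a ++ (i+1) :: (u' ++ (i+1) :: b)) := by
        simpa using hE.congr (a ++ [i+1]) ((i+1) :: b)
      rcases hu' with ⟨x, j, y, rfl⟩ | hcnt
      · refine ⟨_, hE1, Or.inl ⟨a ++ (i+1) :: x, j, y ++ (i+1) :: b, by simp⟩⟩
      by_cases hiu : i ∈ u'
      · obtain ⟨x, y, rfl, hx⟩ := List.eq_append_cons_of_mem hiu
        have hx0 := List.count_eq_zero_of_not_mem hx
        rw [List.count_append, List.count_cons_self, hx0] at hcnt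
        have hy : i ∉ y := List.count_eq_zero.1 (by omega)
        have hi1 := (hub' i (by simp)).1
        have cx : T (i+1) * pw T x = pw T x * T (i+1) := comm_word _ _ fun j hj => by
          have h1 := hub' j (by simp [hj])
          have h2 : j ≠ i := fun h => hx (h ▸ hj)
          exact H.far hi h1.1 (by omega)
        have cy : T (i+1) * pw T y = pw T y * T (i+1) := comm_word _ _ fun j hj => by
          have h1 := hub' j (by simp [hj])
          have h2 : j ≠ i := fun h => hy (h ▸ hj)
          exact H.far hi h1.1 (by omega)
        have hbr := H.hbraid i hi1 hi
        have hE2 : Eqv T ((i+1) :: (x ++ i :: y) ++ [i+1]) (x ++ ([i, i+1, i] ++ y)) := by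
          refine ⟨?_, by simp; omega, ?_⟩
          · simp only [pw_append, pw_cons, pw_nil, mul_one]
            calc T (i+1) * (pw T x * (T i * pw T y)) * T (i+1)
                = (T (i+1) * pw T x) * T i * (pw T y * T (i+1)) := by simp only [mul_assoc]
              _ = pw T x * (T (i+1) * T i * T (i+1)) * pw T y := by
                  rw [cx, ← cy]; simp only [mul_assoc]
              _ = _ := by rw [← hbr]; simp only [mul_assoc]
          · ext k; simp; tauto
        have hE3 := hE1.trans (by simpa using hE2.congr a b)
        have hcb : List.count (i+1) (x ++ i :: y) = 0 :=
          List.count_eq_zero_of_not_mem fun h => by have := hub' _ h; omega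
        simp only [List.count_append, List.count_cons, hu0] at hcb hc
        simp at hcb hc
        obtain ⟨w', hw', hres⟩ := ihc (c - 1) (by omega) _
          (fun j hj => hw j ((hE3.mem j).2 hj)) (by
            simp only [List.count_append, List.count_cons, ha0]
            simp
            omega)
        exact ⟨w', hE3.trans hw', hres⟩
      · have cx : T (i+1) * pw T u' = pw T u' * T (i+1) := comm_word _ _ fun j hj => by
          have h1 := hub' j hj
          have h2 : j ≠ i := fun h => hiu (h ▸ hj)
          exact H.far hi h1.1 (by omega)
        have hE2 : Eqv T ((i+1) :: u' ++ [i+1]) (u' ++ [i+1, i+1]) := by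
          refine ⟨?_, by simp, ?_⟩
          · simp only [pw_append, pw_cons, pw_nil, mul_one, List.cons_append]
            rw [← mul_assoc, cx, mul_assoc]
          · ext k; simp
        have hE3 := hE1.trans (by simpa using hE2.congr a b)
        exact ⟨_, hE3, Or.inl ⟨a ++ u', i+1, b, by simp⟩⟩
    intro w hw
    exact key _ w hw rfl

lemma pw_mem (i : ℕ) (x : List ℕ) (h : ∀ j ∈ x, 1 ≤ j ∧ j < i) :
    pw T x ∈ Algebra.adjoin HeckeCoeffRing {x : A | ∃ j, 1 ≤ j ∧ j < i ∧ x = T j} := by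
  refine Subalgebra.list_prod_mem _ fun y hy => ?_
  obtain ⟨j, hj, rfl⟩ := List.mem_map.1 hy
  exact Algebra.subset_adjoin ⟨j, (h j hj).1, (h j hj).2, rfl⟩

/-- The leading form of the trace of a word. -/
noncomputable def lead (w : List ℕ) : HeckeCoeffRing :=
  qVar ^ (w.length - w.toFinset.card) * zVar ^ w.toFinset.card

lemma Hyp.word (H : Hyp n T Tr) (i : ℕ) (hi : i ≤ n) : ∀ w : List ℕ,
    (∀ j ∈ w, 1 ≤ j ∧ j ≤ i) → Top w.length (Tr (pw T w)) (lead w) := by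
  induction i with
  | zero =>
    intro w hw
    have : w = [] := by
      rw [List.eq_nil_iff_forall_not_mem]
      intro j hj; have := hw j hj; omega
    subst this
    simpa [pw_nil, H.hTr1, lead] using top_one
  | succ i ih =>
    have key : ∀ c, ∀ w : List ℕ, (∀ j ∈ w, 1 ≤ j ∧ j ≤ i + 1) → w.length = c →
        Top w.length (Tr (pw T w)) (lead w) := by
      intro c
      induction c using Nat.strong_induction_on with
      | _ c ihc =>
      intro w hw hc
      obtain ⟨w', hE, hres⟩ := H.normal (i+1) hi w hw
      have hlead : lead w = lead w' := by simp only [lead, hE.len, hE.supp]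
      rw [hE.prod, hlead, hE.len]
      rw [hE.len] at hc
      replace hw : ∀ j ∈ w', 1 ≤ j ∧ j ≤ i + 1 := fun j hj => hw j ((hE.mem j).2 hj)
      clear hE hlead
      rcases hres with ⟨a, j, b, rfl⟩ | hcnt
      · have hj := hw j (by simp)
        have h1 := ihc _ (by rw [← hc]; simp) (a ++ j :: b)
          (fun k hk => hw k (by simp at hk ⊢; tauto)) rfl
        have h2 := ihc _ (by rw [← hc]; simp) (a ++ b)
          (fun k hk => hw k (by simp at hk ⊢; tauto)) rfl
        have hp : pw T (a ++ ([j, j] ++ b)) =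
            (qVar - 1) • pw T (a ++ j :: b) + qVar • pw T (a ++ b) := by
          have hq := H.hquad j hj.1 (by omega)
          simp only [pw_append, pw_cons, pw_nil, mul_one]
          rw [← pow_two, hq]
          simp only [add_mul, mul_add, smul_mul_assoc, mul_smul_comm, one_mul]
        have hs : (a ++ ([j, j] ++ b)).toFinset = (a ++ j :: b).toFinset := by
          ext k; simp
        have hl : lead (a ++ ([j, j] ++ b)) = qVar * lead (a ++ j :: b) := by
          have hle := List.toFinset_card_le (a ++ j :: b)
          simp only [lead, hs]
          rw [← mul_assoc, ← pow_succ']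
          congr 2
          simp at hle ⊢
          omega
        rw [hp, hl, map_add, map_smul, map_smul, smul_eq_mul, smul_eq_mul]
        have h3 := top_q1.mul h1
        have h4 := (top_q.mul h2).low
        have e1 : (a ++ ([j, j] ++ b)).length = 1 + (a ++ j :: b).length := by simp; omega
        rw [e1]
        exact h3.add_low (h4.mono (by simp))
      · by_cases hm : i + 1 ∈ w'
        · obtain ⟨a, b, rfl, ha⟩ := List.eq_append_cons_of_mem hm
          have ha0 := List.count_eq_zero_of_not_mem ha
          rw [List.count_append, List.count_cons_self, ha0] at hcnt
          have hb : i+1 ∉ b := List.count_eq_zero.1 (by omega)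
          have ha' : ∀ j ∈ a, 1 ≤ j ∧ j < i + 1 := fun j hj => by
            have h1 := hw j (by simp [hj])
            have h2 : j ≠ i+1 := fun h => ha (h ▸ hj)
            omega
          have hb' : ∀ j ∈ b, 1 ≤ j ∧ j < i + 1 := fun j hj => by
            have h1 := hw j (by simp [hj])
            have h2 : j ≠ i+1 := fun h => hb (h ▸ hj)
            omega
          have hab := ih (by omega) (a ++ b) (fun j hj => by
            rcases List.mem_append.1 hj with h | h
            · have := ha' j h; omega
            · have := hb' j h; omega)
          have hp : Tr (pw T (a ++ (i+1) :: b)) = zVar * Tr (pw T (a ++ b)) := by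
            rw [pw_append, pw_append, pw_cons, ← mul_assoc]
            exact H.hTrz _ (by omega) hi _ _ (pw_mem _ _ ha') (pw_mem _ _ hb')
          have hs : (a ++ (i+1) :: b).toFinset = insert (i+1) (a ++ b).toFinset := by
            ext k; simp
          have hcard : (a ++ (i+1) :: b).toFinset.card = (a ++ b).toFinset.card + 1 := by
            rw [hs, Finset.card_insert_of_notMem]
            simp [ha, hb]
          have hlen : (a ++ (i+1) :: b).length = (a ++ b).length + 1 := by simp; omega
          have hl : lead (a ++ (i+1) :: b) = zVar * lead (a ++ b) := by
            simp only [lead, hcard, hlen, Nat.add_sub_add_right]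
            ring
          rw [hp, hl, hlen, add_comm]
          exact top_z.mul hab
        · refine ih (by omega) w' fun j hj => ?_
          have h1 := hw j hj
          have h2 : j ≠ i+1 := fun h => hm (h ▸ hj)
          omega
    intro w hw
    exact key _ w hw rfl

/-- weight of a subset -/
noncomputable def wt (n : ℕ) (S : Finset ℕ) : HeckeCoeffRing :=
  zVar ^ S.card * (qVar - zVar) ^ (Finset.Icc 1 n \ S).card

noncomputable def chi (S : Finset ℕ) (j : ℕ) : HeckeCoeffRing := if j ∈ S then qVar else 0

noncomputable def chiF (S : Finset ℕ) (j : ℕ) : HeckeCoeffRing :=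
  if Odd j then chi S j else chi S j + -qVar

lemma chi_word (S : Finset ℕ) (w : List ℕ) :
    (w.map (chi S)).prod = if w.toFinset ⊆ S then qVar ^ w.length else 0 := by
  induction w with
  | nil => simp
  | cons j w ih =>
    rw [List.map_cons, List.prod_cons, ih, chi, List.toFinset_cons]
    simp only [Finset.insert_subset_iff]
    by_cases h1 : j ∈ S <;> by_cases h2 : w.toFinset ⊆ S <;> simp [h1, h2, pow_succ']

lemma sum_wt (s : Finset ℕ) (hs : s ⊆ Finset.Icc 1 n) :
    ∑ S ∈ (Finset.Icc 1 n).powerset, wt n S * (if s ⊆ S then 1 else 0) =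
      qVar ^ (n - s.card) * zVar ^ s.card := by
  have h := Finset.prod_add (fun _ => zVar) (fun i => if i ∈ s then 0 else qVar - zVar)
    (Finset.Icc 1 n)
  have h1 : ∏ i ∈ Finset.Icc 1 n, (zVar + if i ∈ s then 0 else qVar - zVar) =
      qVar ^ (n - s.card) * zVar ^ s.card := by
    rw [← Finset.prod_sdiff hs]
    congr 1
    · rw [Finset.prod_congr rfl (g := fun _ => qVar)]
      · rw [Finset.prod_const, Finset.card_sdiff_of_subset hs]; simp
      · intro x hx; simp [(Finset.mem_sdiff.1 hx).2]
    · rw [Finset.prod_congr rfl (g := fun _ => zVar)]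
      · rw [Finset.prod_const]
      · intro x hx; simp [hx]
  rw [← h1, h]
  refine Finset.sum_congr rfl fun S hS => ?_
  rw [wt, Finset.prod_const, mul_assoc]
  congr 1
  split_ifs with hsS
  · rw [mul_one, ← Finset.prod_const]
    refine Finset.prod_congr rfl fun x hx => ?_
    rw [if_neg fun h => (Finset.mem_sdiff.1 hx).2 (hsS h)]
  · obtain ⟨x, hx, hxS⟩ := Finset.not_subset.1 hsS
    rw [mul_zero]
    symm
    refine Finset.prod_eq_zero (i := x) (Finset.mem_sdiff.2 ⟨hs hx, hxS⟩) ?_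
    simp [hx]

lemma lead_eq (w : List ℕ) (hw : ∀ j ∈ w, 1 ≤ j ∧ j ≤ n) :
    qVar ^ n * lead w =
      ∑ S ∈ (Finset.Icc 1 n).powerset, wt n S * (w.map (chi S)).prod := by
  have hs : w.toFinset ⊆ Finset.Icc 1 n := fun j hj => by
    simpa using hw j (List.mem_toFinset.1 hj)
  have hc := Finset.card_le_card hs
  have hl := List.toFinset_card_le w
  have : ∀ S ∈ (Finset.Icc 1 n).powerset, wt n S * (w.map (chi S)).prod =
      qVar ^ w.length * (wt n S * (if w.toFinset ⊆ S then 1 else 0)) := by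
    intro S _
    rw [chi_word]; split_ifs <;> ring
  rw [Finset.sum_congr rfl this, ← Finset.mul_sum, sum_wt _ hs, lead, ← mul_assoc, ← mul_assoc,
    ← pow_add, ← pow_add]
  congr 2
  simp at hc
  omega

/-- The factor of index `j`. -/
noncomputable def fac (T : ℕ → A) (j : ℕ) : A :=
  if Odd j then T j else T j + (1 - qVar) • (1 : A)

lemma Hyp.expand (H : Hyp n T Tr) (l : List ℕ) : ∀ w : List ℕ,
    (∀ j ∈ w, 1 ≤ j ∧ j ≤ n) → (∀ j ∈ l, 1 ≤ j ∧ j ≤ n) →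
    Top (n + w.length + l.length) (qVar ^ n * Tr (pw T w * (l.map (fac T)).prod))
      (∑ S ∈ (Finset.Icc 1 n).powerset,
        wt n S * ((w.map (chi S)).prod * (l.map (chiF S)).prod)) := by
  induction l with
  | nil =>
    intro w hw _
    have h := (Top.of_hom (by simpa using hom_q.pow n : (qVar ^ n).IsHomogeneous n)).mul
      (H.word n le_rfl w hw)
    rw [lead_eq w hw] at h
    simpa using h
  | cons j l ih =>
    intro w hw hl
    have hj := hl j (by simp)
    have h1 := ih (w ++ [j]) (fun k hk => by
      rcases List.mem_append.1 hk with h | h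
      · exact hw k h
      · simp at h; subst h; exact hj) (fun k hk => hl k (by simp [hk]))
    have h2 := ih w hw (fun k hk => hl k (by simp [hk]))
    have e1 : n + (w ++ [j]).length + l.length = n + w.length + (j :: l).length := by
      simp; omega
    rw [e1] at h1
    simp only [pw_append, pw_cons, pw_nil, mul_one, List.map_append, List.prod_append,
      List.map_cons, List.map_nil, List.prod_cons, List.prod_nil] at h1 ⊢
    by_cases ho : Odd j
    · simp only [fac, chiF, if_pos ho, mul_assoc] at h1 ⊢
      exact h1
    · have h3 := top_1q.mul h2
      have e2 : 1 + (n + w.length + l.length) = n + w.length + (j :: l).length := by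
        simp; omega
      rw [e2] at h3
      have h4 := h1.add h3
      convert h4 using 1
      · have : fac T j = T j + (1 - qVar) • (1 : A) := by simp [fac, ho]
        rw [this, add_mul, mul_add, map_add, smul_mul_assoc, one_mul, mul_smul_comm, map_smul,
          smul_eq_mul, mul_assoc]
        ring
      · rw [Finset.mul_sum, ← Finset.sum_add_distrib]
        refine Finset.sum_congr rfl fun S _ => ?_
        have : chiF S j = chi S j + -qVar := by simp [chiF, ho]
        rw [this]
        ring

lemma q_ne : qVar ≠ 0 := MvPolynomial.X_ne_zero _
lemma z_ne : zVar ≠ 0 := MvPolynomial.X_ne_zero _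
lemma qz_ne : qVar - zVar ≠ 0 := by
  rw [sub_ne_zero]
  intro h
  have := MvPolynomial.X_injective h
  simp at this

lemma chi_gamma (m : ℕ) (hm : 1 ≤ m) :
    ∑ S ∈ (Finset.Icc 1 n).powerset,
      wt n S * (((List.range n).map fun j => chiF S (j + 1)).prod) ^ m ≠ 0 := by
  rw [Finset.sum_eq_single ((Finset.Icc 1 n).filter Odd)]
  · refine mul_ne_zero (mul_ne_zero (pow_ne_zero _ z_ne) (pow_ne_zero _ qz_ne))
      (pow_ne_zero _ ?_)
    refine List.prod_ne_zero fun h => ?_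
    obtain ⟨j, hj, h0⟩ := List.mem_map.1 h
    have hj := List.mem_range.1 hj
    by_cases ho : Odd (j + 1)
    · have hmem : j + 1 ≤ n := hj
      simp [chiF, chi, ho, hmem, q_ne] at h0
    · simp [chiF, chi, ho, q_ne] at h0
  · intro S hS hne
    have hex : ∃ j, j < n ∧ chiF S (j + 1) = 0 := by
      by_contra hcon
      push Not at hcon
      apply hne
      ext k
      rw [Finset.mem_filter]
      constructor
      · intro hk
        have hkn := Finset.mem_powerset.1 hS hk
        refine ⟨hkn, ?_⟩
        by_contra ho
        rw [Finset.mem_Icc] at hkn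
        have := hcon (k - 1) (by omega)
        rw [Nat.sub_add_cancel hkn.1] at this
        simp [chiF, chi, ho, hk] at this
      · rintro ⟨hkn, ho⟩
        by_contra hk
        rw [Finset.mem_Icc] at hkn
        have := hcon (k - 1) (by omega)
        rw [Nat.sub_add_cancel hkn.1] at this
        simp [chiF, chi, ho, hk] at this
    obtain ⟨j, hj, h0⟩ := hex
    rw [List.prod_eq_zero, zero_pow (by omega), mul_zero]
    exact List.mem_map.2 ⟨j, List.mem_range.2 hj, h0⟩
  · intro h
    exact absurd (Finset.mem_powerset.2 (Finset.filter_subset _ _)) h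

lemma prod_rep {M : Type*} [Monoid M] (f : ℕ → M) (n m : ℕ) :
    (((List.replicate m ((List.range n).map (· + 1))).flatten).map f).prod =
      (((List.range n).map fun j => f (j + 1)).prod) ^ m := by
  induction m with
  | zero => simp
  | succ m ih =>
    rw [List.replicate_succ, List.flatten_cons, List.map_append, List.prod_append, ih, pow_succ',
      List.map_map]
    rfl

lemma Hyp.main (H : Hyp n T Tr) (m : ℕ) (hm : 1 ≤ m) :
    Tr ((((List.range n).map fun j => fac T (j + 1)).prod) ^ m) ≠ 0 ∧
    (Tr ((((List.range n).map fun j => fac T (j + 1)).prod) ^ m)).totalDegree = m * n := by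
  have h := H.expand (List.replicate m ((List.range n).map (· + 1))).flatten [] (by simp) (by
    intro j hj
    obtain ⟨l, hl, hjl⟩ := List.mem_flatten.1 hj
    rw [List.eq_of_mem_replicate hl] at hjl
    obtain ⟨k, hk, rfl⟩ := List.mem_map.1 hjl
    have := List.mem_range.1 hk
    omega)
  simp only [prod_rep, pw_nil, one_mul, List.map_nil, List.prod_nil] at h
  obtain ⟨h0, h1⟩ := h.final (chi_gamma m hm)
  have hne := right_ne_zero_of_mul h0
  refine ⟨hne, ?_⟩
  rw [MvPolynomial.totalDegree_mul_of_isDomain (pow_ne_zero _ q_ne) hne] at h1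
  have hq : (qVar ^ n).totalDegree = n := MvPolynomial.totalDegree_X_pow _ _
  rw [hq] at h1
  simp at h1
  omega
end

end Weaving

theorem trace_weaving_totalDegree {A : Type*} [Ring A] [Algebra HeckeCoeffRing A]
    (n : ℕ) (hn : 1 ≤ n) (T : ℕ → A)
    (hcomm : ∀ j k, 1 ≤ j → j ≤ n → 1 ≤ k → k ≤ n → 2 ≤ |(j : ℤ) - (k : ℤ)| →
      T j * T k = T k * T j)
    (hbraid : ∀ j, 1 ≤ j → j + 1 ≤ n →
      T j * T (j + 1) * T j = T (j + 1) * T j * T (j + 1))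
    (hquad : ∀ j, 1 ≤ j → j ≤ n → T j ^ 2 = (qVar - 1) • T j + qVar • (1 : A))
    (Tr : A →ₗ[HeckeCoeffRing] HeckeCoeffRing)
    (hTr1 : Tr 1 = 1)
    (hTrcomm : ∀ a b : A, Tr (a * b) = Tr (b * a))
    (hTrz : ∀ i, 1 ≤ i → i ≤ n → ∀ a b : A,
      a ∈ Algebra.adjoin HeckeCoeffRing {x : A | ∃ j, 1 ≤ j ∧ j < i ∧ x = T j} →
      b ∈ Algebra.adjoin HeckeCoeffRing {x : A | ∃ j, 1 ≤ j ∧ j < i ∧ x = T j} →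
      Tr (a * T i * b) = zVar * Tr (a * b))
    (m : ℕ) (hm : 1 ≤ m) :
    Tr ((((List.range n).map fun j =>
          if Odd (j + 1) then T (j + 1)
          else T (j + 1) + (1 - qVar) • (1 : A)).prod) ^ m) ≠ 0 ∧
      (Tr ((((List.range n).map fun j =>
          if Odd (j + 1) then T (j + 1)
          else T (j + 1) + (1 - qVar) • (1 : A)).prod) ^ m)).totalDegree = m * n := by
  exact Weaving.Hyp.main ⟨hcomm, hbraid, hquad, hTr1, hTrz⟩ m hm
end

section
/- Let n ≥ 1 and m ≥ 1 be integers, let d = 1 if n is odd and d = 0 if n is even, and let r = (n-d)/2. Let γ = (T_1 · (T_2 + (1-q)·1) · T_3 · (T_4 + (1-q)·1) ⋯ F_n)^m ∈ A, where the last factor F_n is T_n if n is odd and T_n + (1-q)·1 if n is even (so that γ equals q^{mr} times the image of the weaving braid (σ_1 σ_2^{-1} σ_3 σ_4^{-1} ⋯ σ_n^{δ})^m in the Hecke algebra). Then the minimal degree of the polynomial Tr(γ) ∈ R equals r + d; that is, every monomial of Tr(γ) with nonzero coefficient has total degree at least r + d, and some monomial of total degree exactly r + d occurs with nonzero coefficient.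 (Equivalently, the trace of the Hecke representation of the weaving braid has lowest degree r + d - mr as a Laurent polynomial in q and z.) -/
namespace Weave
open MvPolynomial
set_option linter.unusedSectionVars false

variable {A : Type*} [Ring A] [Algebra HeckeCoeffRing A]

/-- value of a word -/
def val (T : ℕ → A) (w : List ℕ) : A := (w.map T).prod

@[simp] lemma val_nil (T : ℕ → A) : val T [] = 1 := by simp [val]
@[simp] lemma val_cons (T : ℕ → A) (a : ℕ) (w : List ℕ) : val T (a :: w) = T a * val T w := by
  simp [val]
@[simp] lemma val_append (T : ℕ → A) (v w : List ℕ) : val T (v ++ w) = val T v * val T w := by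
  simp [val]

/-- words in the letters `1..i` -/
def IsW (i : ℕ) (w : List ℕ) : Prop := ∀ x ∈ w, 1 ≤ x ∧ x ≤ i

/-- the ideal of polynomials without constant term -/
noncomputable abbrev I : Ideal HeckeCoeffRing := idealOfVars (Fin 2) ℚ

/-- span of words with at most one top letter, weighted by the loss of support -/
noncomputable def D (T : ℕ → A) (i : ℕ) (S : Finset ℕ) : Submodule HeckeCoeffRing A :=
  Submodule.span HeckeCoeffRing {x | ∃ (p : HeckeCoeffRing) (v : List ℕ), IsW i v ∧ v.count i ≤ 1 ∧
    p ∈ I ^ (S \ v.toFinset).card ∧ x = p • val T v}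

lemma q_mem : qVar ∈ I := by
  unfold qVar I idealOfVars
  exact Ideal.subset_span ⟨0, rfl⟩

lemma z_mem : zVar ∈ I := by
  unfold zVar I idealOfVars
  exact Ideal.subset_span ⟨1, rfl⟩

lemma smul_D (T : ℕ → A) (i : ℕ) (S S' : Finset ℕ) (p : HeckeCoeffRing)
    (hp : p ∈ I ^ (S \ S').card) (x : A) (hx : x ∈ D T i S') : p • x ∈ D T i S := by
  induction hx using Submodule.span_induction with
  | mem x h =>
    obtain ⟨p', v, hv, hc, hp', rfl⟩ := h
    refine Submodule.subset_span ⟨p * p', v, hv, hc, ?_, by rw [mul_smul]⟩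
    have h1 : p * p' ∈ I ^ ((S \ S').card + (S' \ v.toFinset).card) := by
      rw [pow_add]; exact Ideal.mul_mem_mul hp hp'
    refine Ideal.pow_le_pow_right ?_ h1
    refine le_trans (Finset.card_le_card ?_) (Finset.card_union_le _ _)
    intro x; simp only [Finset.mem_sdiff, Finset.mem_union]; tauto
  | zero => simp
  | add x y _ _ hx hy => rw [smul_add]; exact add_mem hx hy
  | smul a x _ hx => rw [smul_comm]; exact Submodule.smul_mem _ _ hx

lemma D_mono (T : ℕ → A) (i : ℕ) (S S' : Finset ℕ) (h : S ⊆ S') (x : A) (hx : x ∈ D T i S') :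
    x ∈ D T i S := by
  have := smul_D T i S S' 1 (by rw [Finset.sdiff_eq_empty_iff_subset.2 h]; simp) x hx
  simpa using this

lemma val_commute (n : ℕ) (T : ℕ → A)
    (hcomm : ∀ j k, 1 ≤ j → j ≤ n → 1 ≤ k → k ≤ n → 2 ≤ |(j : ℤ) - (k : ℤ)| →
      T j * T k = T k * T j) (i : ℕ) (hi : i ≤ n) (w : List ℕ)
    (hw : ∀ x ∈ w, 1 ≤ x ∧ x + 2 ≤ i) : Commute (val T w) (T i) := by
  induction w with
  | nil => simp
  | cons a w ih =>
    rw [val_cons]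
    have h1 := hw a (by simp)
    refine Commute.mul_left ?_ (ih fun x hx => hw x (by simp [hx]))
    refine hcomm a i h1.1 (by omega) (by omega) hi ?_
    rw [abs_sub_comm]
    exact le_trans (by omega) (le_abs_self _)

lemma split_first (i : ℕ) (w : List ℕ) (h : i ∈ w) :
    ∃ a b, w = a ++ i :: b ∧ i ∉ a := by
  obtain ⟨a, b, h1, h2⟩ := List.append_of_mem h |>.elim fun a ⟨b, hb⟩ => 
    (List.eq_append_cons_of_mem h)
  exact ⟨a, b, h1, h2⟩

lemma IsW_succ_of (i : ℕ) (w : List ℕ) (h : IsW (i + 1) w) (h' : i + 1 ∉ w) : IsW i w := by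
  intro x hx
  have := h x hx
  have : x ≠ i + 1 := fun h => h' (h ▸ hx)
  omega

lemma word_mem_D (n : ℕ) (T : ℕ → A)
    (hcomm : ∀ j k, 1 ≤ j → j ≤ n → 1 ≤ k → k ≤ n → 2 ≤ |(j : ℤ) - (k : ℤ)| →
      T j * T k = T k * T j)
    (hbraid : ∀ j, 1 ≤ j → j + 1 ≤ n →
      T j * T (j + 1) * T j = T (j + 1) * T j * T (j + 1))
    (hquad : ∀ j, 1 ≤ j → j ≤ n → T j ^ 2 = (qVar - 1) • T j + qVar • (1 : A))
    (i : ℕ) (hi : i ≤ n) : ∀ w, IsW i w → val T w ∈ D T i w.toFinset := by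
  induction i with
  | zero =>
    intro w hw
    have : w = [] := by
      rcases w with _ | ⟨a, w⟩
      · rfl
      · have := hw a (by simp); omega
    subst this
    exact Submodule.subset_span ⟨1, [], hw, by simp, by simp, by simp⟩
  | succ i ih =>
    specialize ih (by omega)
    intro w
    induction hc : w.count (i + 1) using Nat.strong_induction_on generalizing w with
    | _ c ihc =>
    intro hw
    by_cases hc1 : c ≤ 1
    · exact Submodule.subset_span ⟨1, w, hw, by omega, by simp, by simp⟩
    obtain ⟨a, w1, rfl, ha⟩ := split_first (i + 1) w (List.count_pos_iff.1 (by omega))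
    have hca : a.count (i + 1) = 0 := List.count_eq_zero.2 ha
    have hc2 : w1.count (i + 1) + 1 = c := by simpa [hca] using hc
    obtain ⟨u, b, rfl, hu⟩ := split_first (i + 1) w1 (List.count_pos_iff.1 (by omega))
    have hcu : u.count (i + 1) = 0 := List.count_eq_zero.2 hu
    have hc3 : b.count (i + 1) + 2 = c := by simp [hcu] at hc2; omega
    have hwa : IsW (i + 1) a := fun x hx => hw x (by simp [hx])
    have hwb : IsW (i + 1) b := fun x hx => hw x (by simp [hx])
    have hwu : IsW i u := IsW_succ_of i u (fun x hx => hw x (by simp [hx])) hu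
    have key : ∀ S : Finset ℕ, ∀ x ∈ D T i S, val T a * (T (i + 1) * (x * (T (i + 1) * val T b))) ∈
        D T (i + 1) (a.toFinset ∪ {i + 1} ∪ S ∪ b.toFinset) := by
      intro S x hx
      induction hx using Submodule.span_induction with
      | zero => simp
      | add x y _ _ hx hy => simp only [add_mul, mul_add]; exact add_mem hx hy
      | smul r x _ hx =>
        simp only [smul_mul_assoc, mul_smul_comm]; exact Submodule.smul_mem _ _ hx
      | mem x h =>
        obtain ⟨p, v, hv, hcv, hp, rfl⟩ := h
        simp only [smul_mul_assoc, mul_smul_comm]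
        have hvi : i + 1 ∉ v := fun h => by have := hv _ h; omega
        have hcv' : v.count (i + 1) = 0 := List.count_eq_zero.2 hvi
        by_cases hiv : i ∈ v
        · obtain ⟨e, f, rfl, he⟩ := split_first i v hiv
          have hce : e.count i = 0 := List.count_eq_zero.2 he
          have hcf : f.count i = 0 := by simp [hce] at hcv; exact hcv
          have hf : i ∉ f := List.count_eq_zero.1 hcf
          have hi1 : 1 ≤ i := (hv i (by simp)).1
          have Ce := val_commute n T hcomm (i + 1) hi e (fun x hx => by
            have := hv x (by simp [hx])
            have : x ≠ i := fun h => he (h ▸ hx)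
            omega)
          have Cf := val_commute n T hcomm (i + 1) hi f (fun x hx => by
            have := hv x (by simp [hx])
            have : x ≠ i := fun h => hf (h ▸ hx)
            omega)
          have heq : val T a * (T (i + 1) * (val T (e ++ i :: f) * (T (i + 1) * val T b))) =
              val T (a ++ e ++ i :: (i + 1) :: i :: f ++ b) := by
            simp only [val_append, val_cons]
            calc _ = val T a * ((T (i + 1) * val T e) * T i * (val T f * T (i + 1)) * val T b) := by
                  noncomm_ring
              _ = val T a * (val T e * (T (i + 1) * T i * T (i + 1)) * val T f * val T b) := by
                  rw [Cf.eq, ← Ce.eq]; noncomm_ring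
              _ = _ := by
                  rw [← hbraid i hi1 hi]; noncomm_ring
          rw [heq]
          have hcount : (a ++ e ++ i :: (i + 1) :: i :: f ++ b).count (i + 1) < c := by
            simp at hcv'
            simp [hca]
            omega
          refine smul_D T (i + 1) _ _ p ?_ _ (ihc _ hcount _ rfl ?_)
          · refine Ideal.pow_le_pow_right (Finset.card_le_card ?_) hp
            intro x; simp <;> tauto
          · intro x hx
            have h1 := hwa x
            have h2 := hwb x
            have h3 := hv x
            simp at hx h3
            grind
        · have Cv := val_commute n T hcomm (i + 1) hi v (fun x hx => by
            have := hv x (by simp [hx])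
            have : x ≠ i := fun h => hiv (h ▸ hx)
            omega)
          have heq : val T a * (T (i + 1) * (val T v * (T (i + 1) * val T b))) =
              (qVar - 1) • val T (a ++ v ++ (i + 1) :: b) + qVar • val T (a ++ v ++ b) := by
            simp only [val_append, val_cons]
            calc _ = val T a * ((T (i + 1) * val T v) * T (i + 1) * val T b) := by noncomm_ring
              _ = val T a * (val T v * T (i + 1) ^ 2 * val T b) := by
                  rw [← Cv.eq]; noncomm_ring
              _ = _ := by
                  rw [hquad (i + 1) (by omega) hi]
                  simp only [mul_add, add_mul, smul_mul_assoc, mul_smul_comm, mul_one, mul_assoc]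
          rw [heq, smul_add]
          have hw1 : IsW (i + 1) (a ++ v ++ (i + 1) :: b) := by
            intro x hx
            have h1 := hwa x
            have h2 := hwb x
            have h3 := hv x
            simp at hx
            grind
          have hw2 : IsW (i + 1) (a ++ v ++ b) := fun x hx => hw1 x (by simp at hx ⊢; tauto)
          refine add_mem ?_ ?_
          · rw [smul_comm]
            refine Submodule.smul_mem _ _ ?_
            refine smul_D T (i + 1) _ _ p ?_ _ (ihc _ ?_ _ rfl hw1)
            · refine Ideal.pow_le_pow_right (Finset.card_le_card ?_) hp
              intro x; simp <;> tauto
            · simp [hca, hcv']; omega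
          · rw [smul_smul]
            refine smul_D T (i + 1) _ _ (p * qVar) ?_ _ (ihc _ ?_ _ rfl hw2)
            · have h1 : p * qVar ∈ I ^ ((S \ v.toFinset).card + 1) := by
                rw [pow_succ]; exact Ideal.mul_mem_mul hp q_mem
              refine Ideal.pow_le_pow_right ?_ h1
              refine le_trans (Finset.card_le_card (t := (S \ v.toFinset) ∪ {i + 1}) ?_)
                (Finset.card_union_le _ _)
              intro x; simp <;> tauto
            · simp [hca, hcv']; omega
    have := key _ _ (ih u hwu)
    simp only [val_append, val_cons]
    refine D_mono _ _ _ _ ?_ _ this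
    intro x; simp <;> tauto

lemma val_mem_adjoin (T : ℕ → A) (i : ℕ) (w : List ℕ) (hw : IsW i w) :
    val T w ∈ Algebra.adjoin HeckeCoeffRing {x : A | ∃ j, 1 ≤ j ∧ j < i + 1 ∧ x = T j} := by
  induction w with
  | nil => simp
  | cons a w ih =>
    rw [val_cons]
    have := hw a (by simp)
    exact mul_mem (Algebra.subset_adjoin ⟨a, this.1, by omega, rfl⟩)
      (ih fun x hx => hw x (by simp [hx]))

lemma trace_word (n : ℕ) (T : ℕ → A)
    (hcomm : ∀ j k, 1 ≤ j → j ≤ n → 1 ≤ k → k ≤ n → 2 ≤ |(j : ℤ) - (k : ℤ)| →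
      T j * T k = T k * T j)
    (hbraid : ∀ j, 1 ≤ j → j + 1 ≤ n →
      T j * T (j + 1) * T j = T (j + 1) * T j * T (j + 1))
    (hquad : ∀ j, 1 ≤ j → j ≤ n → T j ^ 2 = (qVar - 1) • T j + qVar • (1 : A))
    (Tr : A →ₗ[HeckeCoeffRing] HeckeCoeffRing)
    (hTrz : ∀ i, 1 ≤ i → i ≤ n → ∀ a b : A,
      a ∈ Algebra.adjoin HeckeCoeffRing {x : A | ∃ j, 1 ≤ j ∧ j < i ∧ x = T j} →
      b ∈ Algebra.adjoin HeckeCoeffRing {x : A | ∃ j, 1 ≤ j ∧ j < i ∧ x = T j} →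
      Tr (a * T i * b) = zVar * Tr (a * b))
    (i : ℕ) (hi : i ≤ n) : ∀ w, IsW i w → Tr (val T w) ∈ I ^ w.toFinset.card := by
  induction i with
  | zero =>
    intro w hw
    have : w = [] := by
      rcases w with _ | ⟨a, w⟩
      · rfl
      · have := hw a (by simp); omega
    subst this
    simp
  | succ i ih =>
    specialize ih (by omega)
    intro w hw
    have key : ∀ S : Finset ℕ, ∀ x ∈ D T (i + 1) S, Tr x ∈ I ^ S.card := by
      intro S x hx
      induction hx using Submodule.span_induction with
      | zero => simp
      | add x y _ _ hx hy => rw [map_add]; exact add_mem hx hy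
      | smul r x _ hx => rw [map_smul]; exact Ideal.mul_mem_left _ _ hx
      | mem x h =>
        obtain ⟨p, v, hv, hcv, hp, rfl⟩ := h
        rw [map_smul, smul_eq_mul]
        suffices h : Tr (val T v) ∈ I ^ v.toFinset.card by
          have h1 : p * Tr (val T v) ∈ I ^ ((S \ v.toFinset).card + v.toFinset.card) := by
            rw [pow_add]; exact Ideal.mul_mem_mul hp h
          refine Ideal.pow_le_pow_right ?_ h1
          refine le_trans (Finset.card_le_card ?_) (Finset.card_union_le _ _)
          intro x; simp <;> tauto
        by_cases hiv : i + 1 ∈ v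
        · obtain ⟨e, f, rfl, he⟩ := split_first (i + 1) v hiv
          have hce : e.count (i + 1) = 0 := List.count_eq_zero.2 he
          have hf : i + 1 ∉ f := by simp [hce] at hcv; exact List.count_eq_zero.1 hcv
          have hwe : IsW i e := IsW_succ_of i e (fun x hx => hv x (by simp [hx])) he
          have hwf : IsW i f := IsW_succ_of i f (fun x hx => hv x (by simp [hx])) hf
          have h1 := hTrz (i + 1) (by omega) hi _ _ (val_mem_adjoin T i e hwe)
            (val_mem_adjoin T i f hwf)
          rw [val_append, val_cons, ← mul_assoc, h1, ← val_append]
          have h2 := Ideal.mul_mem_mul z_mem (ih (e ++ f) (fun x hx => by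
            rcases List.mem_append.1 hx with h | h
            · exact hwe x h
            · exact hwf x h))
          rw [← pow_succ'] at h2
          refine Ideal.pow_le_pow_right ?_ h2
          refine le_trans (Finset.card_le_card (t := (e ++ f).toFinset ∪ {i + 1}) ?_)
            (Finset.card_union_le _ _)
          intro x; simp <;> tauto
        · exact ih v (IsW_succ_of i v hv hiv)
    exact key _ _ (word_mem_D n T hcomm hbraid hquad (i + 1) hi w hw)

/-- factors -/
noncomputable def fac (T : ℕ → A) (j : ℕ) : A :=
  if Odd j then T j else T j + (1 - qVar) • (1 : A)

lemma expand (n : ℕ) (T : ℕ → A) (L : List ℕ) (hL : IsW n L) :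
    ∃ M : ℕ, ∃ e ∈ Submodule.span HeckeCoeffRing {x : A | ∃ w, IsW n w ∧
        (∀ j ∈ L, Odd j → j ∈ w) ∧ (∃ j ∈ w, ¬ Odd j) ∧ x = val T w},
      (L.map (fac T)).prod = (1 - qVar) ^ M • val T (L.filter (fun j => Odd j)) + e := by
  induction L with
  | nil => exact ⟨0, 0, by simp, by simp⟩
  | cons a L ih =>
    obtain ⟨M, e, he, h⟩ := ih fun x hx => hL x (by simp [hx])
    have ha := hL a (by simp)
    have hmul : T a * e ∈ Submodule.span HeckeCoeffRing {x : A | ∃ w, IsW n w ∧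
        (∀ j ∈ a :: L, Odd j → j ∈ w) ∧ (∃ j ∈ w, ¬ Odd j) ∧ x = val T w} := by
      clear h
      induction he using Submodule.span_induction with
      | zero => simp
      | add x y _ _ hx hy => rw [mul_add]; exact add_mem hx hy
      | smul r x _ hx => rw [mul_smul_comm]; exact Submodule.smul_mem _ _ hx
      | mem x h =>
        obtain ⟨w, h1, h2, ⟨j, h3, h4⟩, rfl⟩ := h
        refine Submodule.subset_span ⟨a :: w, ?_, ?_, ⟨j, by simp [h3], h4⟩, by simp⟩
        · intro x hx
          rcases List.mem_cons.1 hx with rfl | h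
          · exact ha
          · exact h1 x h
        · intro x hx ho
          rcases List.mem_cons.1 hx with rfl | h
          · simp
          · simp [h2 x h ho]
    by_cases hodd : Odd a
    · refine ⟨M, T a * e, hmul, ?_⟩
      simp [fac, hodd, h, mul_add]
    · refine ⟨M + 1, T a * e + (1 - qVar) • e + (1 - qVar) ^ M • val T (a :: L.filter (fun j => Odd j)),
        ?_, ?_⟩
      · refine add_mem (add_mem hmul (Submodule.smul_mem _ _ ?_)) (Submodule.smul_mem _ _ ?_)
        · refine Submodule.span_mono ?_ he
          rintro x ⟨w, h1, h2, h3, h4⟩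
          refine ⟨w, h1, ?_, h3, h4⟩
          intro j hj ho
          rcases List.mem_cons.1 hj with rfl | h
          · exact absurd ho hodd
          · exact h2 j h ho
        · refine Submodule.subset_span ⟨_, ?_, ?_, ⟨a, by simp, hodd⟩, rfl⟩
          · intro x hx
            refine hL x ?_
            simp at hx ⊢
            tauto
          · intro j hj ho
            simp at hj ⊢
            tauto
      · simp only [List.map_cons, List.prod_cons, h]
        simp only [fac, hodd, if_false, mul_add, add_mul, smul_mul_assoc, one_mul, mul_smul_comm,
          val_cons, List.filter_cons, decide_false, Bool.false_eq_true]
        rw [smul_add, smul_smul, ← pow_succ]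
        abel

/-- recursion for powers of a generator -/
noncomputable def ab : ℕ → HeckeCoeffRing × HeckeCoeffRing
  | 0 => (0, 1)
  | m + 1 => ((qVar - 1) * (ab m).1 + (ab m).2, qVar * (ab m).1)

lemma pow_eq (T : A) (hquad : T ^ 2 = (qVar - 1) • T + qVar • (1 : A)) (m : ℕ) :
    T ^ m = (ab m).1 • T + (ab m).2 • (1 : A) := by
  induction m with
  | zero => simp [ab]
  | succ m ih =>
    rw [pow_succ, ih, add_mul, smul_mul_assoc, ← pow_two, hquad, ab]
    simp only [smul_add, smul_smul, add_smul, smul_mul_assoc, one_mul]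
    rw [mul_comm (qVar - 1), mul_comm qVar]
    abel

lemma ab_mod (m : ℕ) : qVar ∣ (ab (m + 1)).2 ∧ qVar ∣ (ab (m + 1)).1 - (-1) ^ m := by
  induction m with
  | zero => simp [ab]
  | succ m ih =>
    obtain ⟨h1, h2⟩ := ih
    rw [ab]
    refine ⟨dvd_mul_right _ _, ?_⟩
    have : (qVar - 1) * (ab (m + 1)).1 + (ab (m + 1)).2 - (-1) ^ (m + 1) =
      qVar * (ab (m + 1)).1 - ((ab (m + 1)).1 - (-1) ^ m) + (ab (m + 1)).2 := by ring
    rw [this]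
    exact dvd_add (dvd_sub (dvd_mul_right _ _) h2) h1

/-- the base list of letters -/
def base (n : ℕ) : List ℕ := (List.range n).map (· + 1)

lemma base_isW (n : ℕ) : IsW n (base n) := by
  intro x hx
  simp [base] at hx
  omega

lemma trace_odd (n : ℕ) (T : ℕ → A)
    (hcomm : ∀ j k, 1 ≤ j → j ≤ n → 1 ≤ k → k ≤ n → 2 ≤ |(j : ℤ) - (k : ℤ)| →
      T j * T k = T k * T j)
    (hquad : ∀ j, 1 ≤ j → j ≤ n → T j ^ 2 = (qVar - 1) • T j + qVar • (1 : A))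
    (Tr : A →ₗ[HeckeCoeffRing] HeckeCoeffRing)
    (hTr1 : Tr 1 = 1)
    (hTrz : ∀ i, 1 ≤ i → i ≤ n → ∀ a b : A,
      a ∈ Algebra.adjoin HeckeCoeffRing {x : A | ∃ j, 1 ≤ j ∧ j < i ∧ x = T j} →
      b ∈ Algebra.adjoin HeckeCoeffRing {x : A | ∃ j, 1 ≤ j ∧ j < i ∧ x = T j} →
      Tr (a * T i * b) = zVar * Tr (a * b)) (m : ℕ) (i : ℕ) (hi : i ≤ n) :
    Tr (val T ((base i).filter (fun j => Odd j)) ^ m) =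
      ((ab m).1 * zVar + (ab m).2) ^ ((i + 1) / 2) := by
  induction i with
  | zero => simp [base, hTr1]
  | succ i ih =>
    specialize ih (by omega)
    have hb : base (i + 1) = base i ++ [i + 1] := by simp [base, List.range_succ]
    rw [hb, List.filter_append]
    by_cases ho : Odd (i + 1)
    · have hs : [i + 1].filter (fun j => Odd j) = [i + 1] := by simp [ho]
      have C := val_commute n T hcomm (i + 1) hi ((base i).filter (fun j => Odd j)) (by
        intro x hx
        rw [List.mem_filter] at hx
        have h1 := base_isW i x hx.1
        have h2 : Odd x := by simpa using hx.2
        obtain ⟨a, ha⟩ := ho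
        obtain ⟨b, hb⟩ := h2
        omega)
      rw [hs, val_append, val_cons, val_nil, mul_one, C.mul_pow,
        pow_eq _ (hquad (i + 1) (by omega) hi)]
      have hmem := val_mem_adjoin T i ((base i).filter (fun j => Odd j))
        (fun x hx => base_isW i x (List.mem_of_mem_filter hx))
      have h1 := hTrz (i + 1) (by omega) hi _ 1 (pow_mem hmem m) (one_mem _)
      rw [mul_one, mul_one] at h1
      rw [mul_add, mul_smul_comm, mul_smul_comm, mul_one, map_add, map_smul, map_smul, h1, ih]
      have : (i + 1 + 1) / 2 = (i + 1) / 2 + 1 := by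
        obtain ⟨a, ha⟩ := ho
        omega
      rw [this, smul_eq_mul, smul_eq_mul]
      ring
    · have hs : [i + 1].filter (fun j => Odd j) = [] := by simp [ho]
      rw [hs, List.append_nil, ih]
      congr 1
      obtain ⟨a, ha⟩ := Nat.not_odd_iff_even.1 ho
      omega

lemma card_odd (n : ℕ) : ((base n).toFinset.filter (fun j => Odd j)).card = (n + 1) / 2 := by
  induction n with
  | zero => simp [base]
  | succ i ih =>
    have hb : (base (i + 1)).toFinset = insert (i + 1) (base i).toFinset := by
      ext x; simp [base, List.range_succ] <;> tauto
    have hnot : i + 1 ∉ (base i).toFinset := by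
      intro h
      have := base_isW i _ (List.mem_toFinset.1 h)
      omega
    rw [hb, Finset.filter_insert]
    split_ifs with ho
    · rw [Finset.card_insert_of_notMem (by simp [Finset.mem_filter]; intro h; exact absurd (List.mem_toFinset.2 h) hnot), ih]
      obtain ⟨a, ha⟩ := ho
      omega
    · rw [ih]
      obtain ⟨a, ha⟩ := Nat.not_odd_iff_even.1 ho
      omega

lemma main (n : ℕ) (T : ℕ → A)
    (hcomm : ∀ j k, 1 ≤ j → j ≤ n → 1 ≤ k → k ≤ n → 2 ≤ |(j : ℤ) - (k : ℤ)| →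
      T j * T k = T k * T j)
    (hbraid : ∀ j, 1 ≤ j → j + 1 ≤ n →
      T j * T (j + 1) * T j = T (j + 1) * T j * T (j + 1))
    (hquad : ∀ j, 1 ≤ j → j ≤ n → T j ^ 2 = (qVar - 1) • T j + qVar • (1 : A))
    (Tr : A →ₗ[HeckeCoeffRing] HeckeCoeffRing)
    (hTr1 : Tr 1 = 1)
    (hTrz : ∀ i, 1 ≤ i → i ≤ n → ∀ a b : A,
      a ∈ Algebra.adjoin HeckeCoeffRing {x : A | ∃ j, 1 ≤ j ∧ j < i ∧ x = T j} →
      b ∈ Algebra.adjoin HeckeCoeffRing {x : A | ∃ j, 1 ≤ j ∧ j < i ∧ x = T j} →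
      Tr (a * T i * b) = zVar * Tr (a * b)) (m : ℕ) :
    ∃ M : ℕ, ∃ e ∈ I ^ ((n + 1) / 2 + 1), Tr (((base n).map (fac T)).prod ^ (m + 1)) =
      (1 - qVar) ^ M * ((ab (m + 1)).1 * zVar + (ab (m + 1)).2) ^ ((n + 1) / 2) + e := by
  obtain ⟨M, e, he, h⟩ := expand n T (List.replicate (m + 1) (base n)).flatten (by
    intro x hx
    simp at hx
    exact base_isW n x hx)
  refine ⟨M, Tr e, ?_, ?_⟩
  · clear h
    induction he using Submodule.span_induction with
    | zero => simp
    | add x y _ _ hx hy => rw [map_add]; exact add_mem hx hy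
    | smul r x _ hx => rw [map_smul]; exact Ideal.mul_mem_left _ _ hx
    | mem x h =>
      obtain ⟨w, h1, h2, ⟨j, h3, h4⟩, rfl⟩ := h
      refine Ideal.pow_le_pow_right ?_
        (trace_word n T hcomm hbraid hquad Tr hTrz n le_rfl w h1)
      rw [← card_odd, ← Finset.card_insert_of_notMem (a := j) (by simp [h4])]
      refine Finset.card_le_card ?_
      intro x hx
      rw [Finset.mem_insert, Finset.mem_filter, List.mem_toFinset] at hx
      rw [List.mem_toFinset]
      rcases hx with rfl | ⟨hx, ho⟩
      · exact h3
      · exact h2 x (by simpa using hx) ho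
  · have hl : ((base n).map (fac T)).prod ^ (m + 1) =
        ((List.replicate (m + 1) (base n)).flatten.map (fac T)).prod := by
      simp [List.map_flatten, List.prod_flatten]
    have hr : val T ((List.replicate (m + 1) (base n)).flatten.filter (fun j => Odd j)) =
        val T ((base n).filter (fun j => Odd j)) ^ (m + 1) := by
      simp [val, List.filter_flatten, List.map_flatten, List.prod_flatten]
    rw [hl, h, map_add, map_smul, hr, trace_odd n T hcomm hquad Tr hTr1 hTrz _ n le_rfl,
      smul_eq_mul]

lemma coeff_main (k M m : ℕ) (e : HeckeCoeffRing) (he : e ∈ I ^ (k + 1)) :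
    ((1 - qVar) ^ M * ((ab (m + 1)).1 * zVar + (ab (m + 1)).2) ^ k + e) ∈ I ^ k ∧
    coeff (Finsupp.single 1 k)
      ((1 - qVar) ^ M * ((ab (m + 1)).1 * zVar + (ab (m + 1)).2) ^ k + e) ≠ 0 := by
  obtain ⟨⟨b, hb⟩, ⟨a, ha⟩⟩ := ab_mod m
  refine ⟨add_mem (Ideal.mul_mem_left _ _ (Ideal.pow_mem_pow ?_ k))
    (Ideal.pow_le_pow_right (Nat.le_succ k) he), ?_⟩
  · rw [hb]
    exact add_mem (Ideal.mul_mem_left _ _ z_mem) (Ideal.mul_mem_right _ _ q_mem)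
  · have he0 : coeff (Finsupp.single 1 k) e = 0 := by
      by_contra hne
      have := (mem_pow_idealOfVars_iff _ _).1 he _ (mem_support_iff.2 hne)
      simp at this
    have hd : qVar ∣ (1 - qVar) ^ M * ((ab (m + 1)).1 * zVar + (ab (m + 1)).2) ^ k -
        ((-1) ^ m * zVar) ^ k := by
      have h1 : qVar ∣ (1 - qVar) ^ M - 1 := by
        have := sub_dvd_pow_sub_pow (1 - qVar) 1 M
        rw [one_pow] at this
        exact dvd_trans ⟨-1, by ring⟩ this
      have h2 : qVar ∣ ((ab (m + 1)).1 * zVar + (ab (m + 1)).2) ^ k - ((-1) ^ m * zVar) ^ k := by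
        refine dvd_trans ⟨a * zVar + b, ?_⟩ (sub_dvd_pow_sub_pow _ _ k)
        linear_combination zVar * ha + hb
      obtain ⟨c, hc⟩ := h1
      obtain ⟨d, hd⟩ := h2
      exact ⟨c * ((ab (m + 1)).1 * zVar + (ab (m + 1)).2) ^ k + d, by
        linear_combination hc * ((ab (m + 1)).1 * zVar + (ab (m + 1)).2) ^ k + hd⟩
    obtain ⟨h, hh⟩ := hd
    rw [sub_eq_iff_eq_add] at hh
    rw [coeff_add, he0, hh, coeff_add, qVar, coeff_X_mul']
    have : ((-1) ^ m * zVar) ^ k = C (((-1) ^ m) ^ k) * X 1 ^ k := by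
      simp [zVar, mul_pow]
    rw [this, coeff_C_mul, coeff_X_pow]
    simp

end Weave

theorem trace_weaving_minimal_degree {A : Type*} [Ring A] [Algebra HeckeCoeffRing A]
    (n : ℕ) (hn : 1 ≤ n) (T : ℕ → A)
    (hcomm : ∀ j k, 1 ≤ j → j ≤ n → 1 ≤ k → k ≤ n → 2 ≤ |(j : ℤ) - (k : ℤ)| →
      T j * T k = T k * T j)
    (hbraid : ∀ j, 1 ≤ j → j + 1 ≤ n →
      T j * T (j + 1) * T j = T (j + 1) * T j * T (j + 1))
    (hquad : ∀ j, 1 ≤ j → j ≤ n → T j ^ 2 = (qVar - 1) • T j + qVar • (1 : A))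
    (Tr : A →ₗ[HeckeCoeffRing] HeckeCoeffRing)
    (hTr1 : Tr 1 = 1)
    (hTrcomm : ∀ a b : A, Tr (a * b) = Tr (b * a))
    (hTrz : ∀ i, 1 ≤ i → i ≤ n → ∀ a b : A,
      a ∈ Algebra.adjoin HeckeCoeffRing {x : A | ∃ j, 1 ≤ j ∧ j < i ∧ x = T j} →
      b ∈ Algebra.adjoin HeckeCoeffRing {x : A | ∃ j, 1 ≤ j ∧ j < i ∧ x = T j} →
      Tr (a * T i * b) = zVar * Tr (a * b))
    (m : ℕ) (hm : 1 ≤ m) :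
    Tr ((((List.range n).map fun j =>
          if Odd (j + 1) then T (j + 1)
          else T (j + 1) + (1 - qVar) • (1 : A)).prod) ^ m) ≠ 0 ∧
    (∀ mo ∈ (Tr ((((List.range n).map fun j =>
          if Odd (j + 1) then T (j + 1)
          else T (j + 1) + (1 - qVar) • (1 : A)).prod) ^ m)).support,
        (n - (if Odd n then 1 else 0)) / 2 + (if Odd n then 1 else 0) ≤ ∑ i : Fin 2, mo i) ∧
    (∃ mo ∈ (Tr ((((List.range n).map fun j =>
          if Odd (j + 1) then T (j + 1)
          else T (j + 1) + (1 - qVar) • (1 : A)).prod) ^ m)).support,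
        ∑ i : Fin 2, mo i = (n - (if Odd n then 1 else 0)) / 2 + (if Odd n then 1 else 0)) := by
  have hk : (n - (if Odd n then 1 else 0)) / 2 + (if Odd n then 1 else 0) = (n + 1) / 2 := by
    split_ifs with h
    · obtain ⟨a, ha⟩ := h
      omega
    · obtain ⟨a, ha⟩ := Nat.not_odd_iff_even.1 h
      omega
  obtain ⟨m, rfl⟩ : ∃ m', m = m' + 1 := ⟨m - 1, by omega⟩
  have hb : ((List.range n).map fun j =>
          if Odd (j + 1) then T (j + 1)
          else T (j + 1) + (1 - qVar) • (1 : A)) = (Weave.base n).map (Weave.fac T) := by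
    simp [Weave.base, Weave.fac, Function.comp_def]
  rw [hk, hb]
  obtain ⟨M, e, he, h⟩ := Weave.main n T hcomm hbraid hquad Tr hTr1 hTrz m
  obtain ⟨h1, h2⟩ := Weave.coeff_main _ M m e he
  rw [← h] at h1 h2
  have hs := MvPolynomial.mem_support_iff.2 h2
  refine ⟨?_, ?_, ⟨_, hs, by simp⟩⟩
  · intro h0
    rw [h0] at h2
    simp at h2
  · intro mo hmo
    have := (MvPolynomial.mem_pow_idealOfVars_iff _ _).1 h1 mo hmo
    rwa [Finsupp.degree_eq_sum] at this
end
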